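/- There is an absolute constant c > 0 such that for all integers D, k, n with k ≤ n^{1/64} and D ≤ 2 log n: if G ~ G(n,k,n^{−2/D}), then with probability tending to 1 as n → ∞, every tree-like semantic Res(⊕) (resolution over parities) refutation of the unary block clique formula bclique_u(G,k) has length at least n^{c·D}. -/

import Mathlib

open Finset

abbrev Vtx (k n : ℕ) := Fin k × Fin n
abbrev Tup (k n : ℕ) := Fin k → Fin n

/-- Potential edges: pairs of vertices lying in distinct blocks. -/
def potEdges (k n : ℕ) : Finset (Sym2 (Vtx k n)) :=
  Finset.univ.filter fun e => ¬ (Sym2.map Prod.fst e).IsDiag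

open Classical in
/-- The probability, under the distribution `G(n,k,p)` (each potential edge present
independently with probability `p`), that the sampled graph satisfies `P`. -/
noncomputable def probG (k n : ℕ) (p : ℝ) (P : Finset (Sym2 (Vtx k n)) → Prop) : ℝ :=
  ∑ G ∈ (potEdges k n).powerset,
    if P G then p ^ G.card * (1 - p) ^ ((potEdges k n).card - G.card) else 0

/-- The biased character `χ_E(G) = ∏_{e ∈ E} χ_e(G)`. -/
noncomputable def chiE {k n : ℕ} (p : ℝ) (G E : Finset (Sym2 (Vtx k n))) : ℝ :=
  ∏ e ∈ E, if e ∈ G then (1 - p) / p else -1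

/-- The edge of a tuple `t` joining its vertices in blocks `i` and `j`. -/
def tupEdge {k n : ℕ} (t : Tup k n) (i j : Fin k) : Sym2 (Vtx k n) := s((i, t i), (j, t j))

/-- `t` is a `k`-clique of `G`. -/
def IsClique {k n : ℕ} (G : Finset (Sym2 (Vtx k n))) (t : Tup k n) : Prop :=
  ∀ i j : Fin k, i ≠ j → tupEdge t i j ∈ G

/-- `S` is a vertex cover of the graph `H` on `[k]`. -/
def IsCover {k : ℕ} (H : Finset (Sym2 (Fin k))) (S : Finset (Fin k)) : Prop :=
  ∀ e ∈ H, ∃ v ∈ S, v ∈ e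

/-- Minimum vertex cover size. -/
noncomputable def vc {k : ℕ} (H : Finset (Sym2 (Fin k))) : ℕ :=
  sInf {m | ∃ S : Finset (Fin k), S.card = m ∧ IsCover H S}

/-- The graph `H(t)` on the vertices of the tuple `t` obtained from a graph `H` on `[k]`. -/
def graphOf {k n : ℕ} (H : Finset (Sym2 (Fin k))) (t : Tup k n) : Finset (Sym2 (Vtx k n)) :=
  H.image (Sym2.map fun i => (i, t i))

open Classical in
/-- The pseudo-measure `μ_{G,d}` on a single tuple. -/
noncomputable def mu {k n : ℕ} (p : ℝ) (G : Finset (Sym2 (Vtx k n))) (d : ℝ) (t : Tup k n) : ℝ :=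
  ((n : ℝ) ^ k)⁻¹ *
    ∑ H ∈ Finset.univ.filter
        (fun H : Finset (Sym2 (Fin k)) => (∀ e ∈ H, ¬ e.IsDiag) ∧ (vc H : ℝ) ≤ d),
      chiE p G (graphOf H t)

/-- The pseudo-measure `μ_{G,d}` on a set of tuples. -/
noncomputable def muSet {k n : ℕ} (p : ℝ) (G : Finset (Sym2 (Vtx k n))) (d : ℝ)
    (Q : Finset (Tup k n)) : ℝ :=
  ∑ t ∈ Q, mu p G d t

/-- `Q` is ruled out by a missing edge: some potential edge `e ∉ E(G)` satisfies `e ⊆ t`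
for every `t ∈ Q`. -/
def RuledOut {k n : ℕ} (G : Finset (Sym2 (Vtx k n))) (Q : Finset (Tup k n)) : Prop :=
  ∃ e ∈ potEdges k n, e ∉ G ∧ ∀ t ∈ Q, ∀ u ∈ e, t u.1 = u.2


/-- A Boolean function on `N` variables, viewed as the indicator of the set of
assignments it rules out. -/
abbrev BFunc (N : ℕ) := (Fin N → Bool) → Bool

/-- A clause over `N` Boolean variables: a disjunction of literals over distinct
variables, recorded by the polarity (if any) of each variable. -/
abbrev Clause (N : ℕ) := Fin N → Option Bool

/-- The assignment `α` satisfies the clause `c`. -/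
def clauseSat {N : ℕ} (c : Clause N) (α : Fin N → Bool) : Prop :=
  ∃ i b, c i = some b ∧ α i = b

/-- The indicator of the falsifying assignments of the clause `c`. -/
def falsInd {N : ℕ} (c : Clause N) : BFunc N :=
  fun α => decide (∀ i b, c i = some b → α i ≠ b)

/-- A tree-like semantic proof: a tree each of whose nodes is labelled with a Boolean
function and has at most two children. -/
inductive SemProof (N : ℕ) : Type
  | leaf : BFunc N → SemProof N
  | node1 : BFunc N → SemProof N → SemProof N
  | node2 : BFunc N → SemProof N → SemProof N → SemProof N

namespace SemProof

/-- The function labelling the root. -/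
def root {N : ℕ} : SemProof N → BFunc N
  | leaf f => f
  | node1 f _ => f
  | node2 f _ _ => f

/-- The length of a tree-like proof: its number of lines. -/
def length {N : ℕ} : SemProof N → ℕ
  | leaf _ => 1
  | node1 _ s => s.length + 1
  | node2 _ s t => s.length + t.length + 1

/-- A valid tree-like `sem(F)` derivation from the CNF formula `A`: every line either is
the indicator of the falsifying assignments of a clause of `A`, or belongs to `F` and is
semantically implied by its (at most two) premises. -/
def Valid {N : ℕ} (F : Set (BFunc N)) (A : Finset (Clause N)) : SemProof N → Prop
  | leaf f => ∃ c ∈ A, f = falsInd c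
  | node1 f s => ((∃ c ∈ A, f = falsInd c) ∨
      (f ∈ F ∧ ∀ α, f α = true → s.root α = true)) ∧ Valid F A s
  | node2 f s t => ((∃ c ∈ A, f = falsInd c) ∨
      (f ∈ F ∧ ∀ α, f α = true → s.root α = true ∨ t.root α = true)) ∧
      Valid F A s ∧ Valid F A t

end SemProof

/-- A tree-like `sem(F)` refutation of `A`: a valid derivation whose final line is the
constant-`1` function (ruling out every assignment, i.e. contradiction). -/
def IsRefutation {N : ℕ} (F : Set (BFunc N)) (A : Finset (Clause N)) (π : SemProof N) : Prop :=
  SemProof.Valid F A π ∧ ∀ α, π.root α = true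

/-- A tree-like `sem(F)` derivation of the function `g` from `A`. -/
def IsDerivation {N : ℕ} (F : Set (BFunc N)) (A : Finset (Clause N)) (π : SemProof N)
    (g : BFunc N) : Prop :=
  SemProof.Valid F A π ∧ π.root = g


/-- The variable of the unary block clique formula corresponding to the vertex `v`. -/
def vidx {k n : ℕ} (v : Vtx k n) : Fin (k * n) := finProdFinEquiv v

open Classical in
/-- The unary block clique formula `bclique_u(G,k)`, a CNF formula over the variables
`{x_v : v ∈ V_1 ∪ ⋯ ∪ V_k}`: edge axioms `¬x_u ∨ ¬x_v` for every pair of vertices in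
distinct blocks with `{u,v} ∉ E(G)`, and block axioms `∨_{v ∈ V_i} x_v`. -/
noncomputable def bcliqueU (k n : ℕ) (G : Finset (Sym2 (Vtx k n))) :
    Finset (Clause (k * n)) :=
  ((Finset.univ.filter fun uv : Vtx k n × Vtx k n =>
      uv.1.1 ≠ uv.2.1 ∧ s(uv.1, uv.2) ∉ G).image
    fun uv => (fun w => if w = vidx uv.1 ∨ w = vidx uv.2 then some false else none :
      Clause (k * n))) ∪
  (Finset.univ.image fun i : Fin k =>
    (fun w => if (finProdFinEquiv.symm w).1 = i then some true else none :
      Clause (k * n)))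

/-- The lines of the semantic `Res(⊕)` proof system: Boolean functions that are
(indicators of the falsifying assignments of) disjunctions of `𝔽₂`-affine linear forms
`Σ_{i ∈ I} xᵢ = b`. -/
def ResLinLines (N : ℕ) : Set (BFunc N) :=
  {f | ∃ S : Finset ((Fin N → ZMod 2) × ZMod 2), ∀ α,
    f α = !(decide (∃ q ∈ S, (∑ i, q.1 i * (if α i then 1 else 0)) = q.2))}

/-! ### Reduction from tree-like proofs to measures -/

section Reduction

/-- An affine equation. -/
abbrev AEq (N : ℕ) := (Fin N → ZMod 2) × ZMod 2

/-- The value of a linear form. -/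
def lf {N : ℕ} (q : Fin N → ZMod 2) (α : Fin N → Bool) : ZMod 2 :=
  ∑ i, q i * (if α i then 1 else 0)

/-- The affine subspace of a list of equations. -/
def inA {N : ℕ} (Q : List (AEq N)) (α : Fin N → Bool) : Prop := ∀ q ∈ Q, lf q.1 α = q.2

/-- Pointwise sum of three assignments. -/
def x3 {N : ℕ} (a b c : Fin N → Bool) : Fin N → Bool := fun i => (a i).xor ((b i).xor (c i))

theorem lf_x3 {N : ℕ} (q : Fin N → ZMod 2) (a b c : Fin N → Bool) :
    lf q (x3 a b c) = lf q a + lf q b + lf q c := by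
  unfold lf x3
  rw [← sum_add_distrib, ← sum_add_distrib]
  apply sum_congr rfl
  intro i _
  rw [← mul_add, ← mul_add]
  congr 1
  cases a i <;> cases b i <;> cases c i <;> decide

theorem zmod2_add_self (x : ZMod 2) : x + x = 0 := CharTwo.add_self_eq_zero x

theorem inA_x3 {N : ℕ} {Q : List (AEq N)} {a b c : Fin N → Bool} (ha : inA Q a) (hb : inA Q b)
    (hc : inA Q c) : inA Q (x3 a b c) := by
  intro q hq
  rw [lf_x3, ha q hq, hb q hq, hc q hq, zmod2_add_self, zero_add]

theorem x3_cancel {N : ℕ} (a b c : Fin N → Bool) : x3 (x3 a b c) b c = a := by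
  funext i
  unfold x3
  cases a i <;> cases b i <;> cases c i <;> rfl

theorem zmod2_ne {x y : ZMod 2} : x ≠ y ↔ x = y + 1 := by
  revert x y; decide

/-- If an affine space is covered by two affine spaces, one equation separates. -/
theorem cover_split {N : ℕ} (A B C : List (AEq N))
    (h : ∀ α, inA A α → inA B α ∨ inA C α) :
    (∀ α, inA A α → inA B α) ∨ (∀ α, inA A α → inA C α) ∨
    ∃ q : AEq N, (∀ α, inA ((q.1, q.2 + 1) :: A) α → inA B α) ∧ (∀ α, inA (q :: A) α → inA C α) := by
  by_cases hC : ∀ α, inA A α → inA C α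
  · exact Or.inr (Or.inl hC)
  by_cases hB : ∀ α, inA A α → inA B α
  · exact Or.inl hB
  push Not at hC hB
  obtain ⟨a0, ha0, ha0C⟩ := hC
  obtain ⟨a, ha, haB⟩ := hB
  unfold inA at ha0C
  push Not at ha0C
  obtain ⟨q, hq, hqa⟩ := ha0C
  have hA0 : ∀ α, inA ((q.1, q.2 + 1) :: A) α → inA B α := by
    intro α hα
    have h1 : lf q.1 α = q.2 + 1 := hα (q.1, q.2 + 1) List.mem_cons_self
    have h2 : inA A α := fun r hr => hα r (List.mem_cons_of_mem _ hr)
    rcases h α h2 with h3 | h3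
    · exact h3
    · have hne : ∀ x : ZMod 2, ¬ x = x + 1 := by decide
      exact absurd h1 (by rw [h3 q hq]; exact hne _)
  refine Or.inr (Or.inr ⟨q, hA0, ?_⟩)
  intro z hz
  have hzA : inA A z := fun r hr => hz r (List.mem_cons_of_mem _ hr)
  have hzq : lf q.1 z = q.2 := hz q List.mem_cons_self
  rcases h z hzA with hzB | hzC
  swap
  · exact hzC
  exfalso
  have ha0q : lf q.1 a0 = q.2 + 1 := zmod2_ne.1 hqa
  have ha0B : inA B a0 := hA0 a0 (by
    intro r hr
    rcases List.mem_cons.1 hr with rfl | hr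
    · exact ha0q
    · exact ha0 r hr)
  have haq : lf q.1 a = q.2 := by
    by_contra hne
    exact haB (hA0 a (by
      intro r hr
      rcases List.mem_cons.1 hr with rfl | hr
      · exact zmod2_ne.1 hne
      · exact ha r hr))
  have hs : inA B (x3 a z a0) := hA0 _ (by
    intro r hr
    rcases List.mem_cons.1 hr with rfl | hr
    · change lf q.1 _ = q.2 + 1
      rw [lf_x3, haq, hzq, ha0q, zmod2_add_self, zero_add]
    · exact inA_x3 ha hzA ha0 r hr)
  exact haB (by rw [← x3_cancel a z a0]; exact inA_x3 hs hzB ha0B)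

/-- Lines are affine. -/
theorem line_affine {N : ℕ} {f : BFunc N} (hf : f ∈ ResLinLines N) :
    ∃ Q : List (AEq N), ∀ α, f α = true ↔ inA Q α := by
  obtain ⟨S, hS⟩ := hf
  refine ⟨S.toList.map (fun q => (q.1, q.2 + 1)), fun α => ?_⟩
  rw [hS α]
  simp only [Bool.not_eq_true', decide_eq_false_iff_not, inA, List.mem_map, Finset.mem_toList]
  push Not
  constructor
  · rintro h q ⟨r, hr, rfl⟩
    exact zmod2_ne.1 (h r hr)
  · intro h q hq
    exact zmod2_ne.2 (h _ ⟨q, hq, rfl⟩)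

theorem clause_affine {N : ℕ} (c : Clause N) :
    ∃ Q : List (AEq N), ∀ α, falsInd c α = true ↔ inA Q α := by
  have hl : ∀ (i : Fin N) (α : Fin N → Bool), lf (Pi.single i 1) α = if α i then 1 else 0 := by
    intro i α
    unfold lf
    rw [sum_eq_single i]
    · simp
    · intro j _ hj; simp [Pi.single_apply, hj]
    · simp
  refine ⟨(univ.filter fun q : AEq N => ∃ i b, c i = some b ∧ q = (Pi.single i 1, if b then 0 else 1)).toList,
    fun α => ?_⟩
  simp only [falsInd, decide_eq_true_eq, inA, Finset.mem_toList, mem_filter, mem_univ, true_and]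
  constructor
  · rintro h q ⟨i, b, hi, rfl⟩
    have := h i b hi
    rw [hl]
    cases b <;> cases hα : α i <;> simp_all
  · intro h i b hi hb
    have := h _ ⟨i, b, hi, rfl⟩
    rw [hl, hb] at this
    cases b <;> simp at this

theorem root_affine {N : ℕ} {A : Finset (Clause N)} {π : SemProof N}
    (h : SemProof.Valid (ResLinLines N) A π) :
    ∃ Q : List (AEq N), ∀ α, π.root α = true ↔ inA Q α := by
  cases π with
  | leaf f => obtain ⟨c, _, rfl⟩ := h; exact clause_affine c
  | node1 f s =>
    obtain ⟨h | h, _⟩ := h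
    · obtain ⟨c, _, rfl⟩ := h; exact clause_affine c
    · exact line_affine h.1
  | node2 f s t =>
    obtain ⟨h | h, _⟩ := h
    · obtain ⟨c, _, rfl⟩ := h; exact clause_affine c
    · exact line_affine h.1

variable {k n : ℕ}

/-- The one-hot assignment of a tuple. -/
def oneHot (t : Tup k n) : Fin (k * n) → Bool := fun w =>
  decide (t (finProdFinEquiv.symm w).1 = (finProdFinEquiv.symm w).2)

theorem oneHot_vidx (t : Tup k n) (v : Vtx k n) : oneHot t (vidx v) = decide (t v.1 = v.2) := by
  simp [oneHot, vidx]

theorem lf_oneHot (q : Fin (k * n) → ZMod 2) (t : Tup k n) :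
    lf q (oneHot t) = ∑ i, q (vidx (i, t i)) := by
  unfold lf
  rw [← Equiv.sum_comp (finProdFinEquiv : Fin k × Fin n ≃ Fin (k * n)), Fintype.sum_prod_type]
  apply sum_congr rfl
  intro i _
  rw [sum_eq_single (t i)]
  · simp [oneHot, vidx]
  · intro y _ hy
    simp [oneHot, Ne.symm hy]
  · simp

/-- The sign of an element of `ZMod 2`. -/
noncomputable def sg (x : ZMod 2) : ℝ := if x = 0 then 1 else -1

theorem sg_add (x y : ZMod 2) : sg (x + y) = sg x * sg y := by
  have : ∀ x y : ZMod 2, (x + y = 0 ↔ (x = 0 ↔ y = 0)) := by decide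
  unfold sg
  rw [if_congr (this x y) rfl rfl]
  by_cases hx : x = 0 <;> by_cases hy : y = 0 <;> simp [hx, hy]

theorem sg_sum {ι : Type*} (s : Finset ι) (f : ι → ZMod 2) : sg (∑ i ∈ s, f i) = ∏ i ∈ s, sg (f i) := by
  classical
  induction s using Finset.induction_on with
  | empty => simp [sg]
  | insert a s ha ih => rw [sum_insert ha, prod_insert ha, sg_add, ih]

theorem sg_or (x : ZMod 2) : sg x = 1 ∨ sg x = -1 := by
  unfold sg; split_ifs <;> simp

open Classical in
/-- Averaging over characters. -/
theorem affine_sum_le (ν : Tup k n → ℝ) (lam : ℝ)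
    (h : ∀ g : Fin k → Fin n → ℝ, (∀ i x, g i x = 1 ∨ g i x = -1) →
      |∑ t, ν t * ∏ i, g i (t i)| ≤ lam) (Q : List (AEq (k * n))) :
    ∀ g : Fin k → Fin n → ℝ, (∀ i x, g i x = 1 ∨ g i x = -1) →
      |∑ t, if inA Q (oneHot t) then ν t * ∏ i, g i (t i) else 0| ≤ lam := by
  induction Q with
  | nil => intro g hg; simpa [inA] using h g hg
  | cons q Q ih =>
    intro g hg
    have h1 := ih g hg
    have h2 := ih (fun i x => g i x * sg (q.1 (vidx (i, x)))) (by
      intro i x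
      rcases hg i x with a | a <;> rcases sg_or (q.1 (vidx (i, x))) with b | b <;> simp [a, b])
    have key : ∀ t : Tup k n, (if inA (q :: Q) (oneHot t) then ν t * ∏ i, g i (t i) else 0) =
        (1 / 2) * (if inA Q (oneHot t) then ν t * ∏ i, g i (t i) else 0) +
        (sg q.2 / 2) * (if inA Q (oneHot t) then
          ν t * ∏ i, (g i (t i) * sg (q.1 (vidx (i, t i)))) else 0) := by
      intro t
      have hiff : inA (q :: Q) (oneHot t) ↔ lf q.1 (oneHot t) = q.2 ∧ inA Q (oneHot t) := by
        simp [inA]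
      rw [prod_mul_distrib, ← sg_sum, ← lf_oneHot]
      by_cases hQ : inA Q (oneHot t)
      · simp only [hiff, hQ, and_true, if_true]
        have hz : ∀ x y : ZMod 2, sg y * sg x = if x = y then 1 else -1 := by
          intro x y
          rw [← sg_add]
          have : ∀ x y : ZMod 2, (y + x = 0 ↔ x = y) := by decide
          unfold sg
          rw [if_congr (this x y) rfl rfl]
        have := hz (lf q.1 (oneHot t)) q.2
        split_ifs at this ⊢ with hh
        · linear_combination (-(1:ℝ)/2 * ν t * ∏ i, g i (t i)) * this
        · linear_combination (-(1:ℝ)/2 * ν t * ∏ i, g i (t i)) * this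
      · simp [hiff, hQ]
    simp only [key, sum_add_distrib, ← mul_sum]
    have hs : |sg q.2 / 2| = 1 / 2 := by
      rcases sg_or q.2 with a | a <;> rw [a] <;> norm_num [abs_div]
    calc _ ≤ _ := abs_add_le _ _
      _ ≤ 1 / 2 * lam + 1 / 2 * lam := by
        rw [abs_mul, abs_mul, hs]
        have : |(1:ℝ) / 2| = 1 / 2 := by norm_num
        rw [this]
        gcongr
      _ = lam := by ring

open Classical in
theorem reduction (G : Finset (Sym2 (Vtx k n))) (μ : Tup k n → ℝ) (lam : ℝ) (hlam : 0 ≤ lam)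
    (h : ∀ u v : Vtx k n, u.1 ≠ v.1 → s(u, v) ∉ G → ∀ g : Fin k → Fin n → ℝ,
      (∀ i x, g i x = 1 ∨ g i x = -1) →
      |∑ t, (if t u.1 = u.2 ∧ t v.1 = v.2 then μ t else 0) * ∏ i, g i (t i)| ≤ lam)
    (π : SemProof (k * n)) (hπ : SemProof.Valid (ResLinLines (k * n)) (bcliqueU k n G) π) :
    ∀ Q : List (AEq (k * n)), (∀ α, inA Q α → π.root α = true) →
      |∑ t, if inA Q (oneHot t) then μ t else 0| ≤ π.length * lam := by
  have hax : ∀ c ∈ bcliqueU k n G, ∀ Q : List (AEq (k * n)), (∀ α, inA Q α → falsInd c α = true) →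
      |∑ t, if inA Q (oneHot t) then μ t else 0| ≤ lam := by
    intro c hc Q hQ
    unfold bcliqueU at hc
    simp only [mem_union, mem_image, mem_filter, mem_univ, true_and] at hc
    rcases hc with ⟨⟨u, v⟩, ⟨huv, hG⟩, rfl⟩ | ⟨i, rfl⟩
    · have h1 := affine_sum_le _ lam (h u v huv hG) Q (fun _ _ => 1) (by simp)
      have : ∀ t : Tup k n, (if inA Q (oneHot t) then μ t else 0) =
          if inA Q (oneHot t) then (if t u.1 = u.2 ∧ t v.1 = v.2 then μ t else 0) *
            ∏ i : Fin k, ((fun _ _ => 1 : Fin k → Fin n → ℝ) i (t i)) else 0 := by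
        intro t
        by_cases hq : inA Q (oneHot t)
        · have hf := hQ _ hq
          simp only [falsInd, decide_eq_true_eq] at hf
          have a1 := hf (vidx u) false (by simp)
          have a2 := hf (vidx v) false (by simp)
          rw [oneHot_vidx] at a1 a2
          simp at a1 a2
          simp [hq, a1, a2]
        · simp [hq]
      simp only [this]
      exact h1
    · have : ∀ t : Tup k n, (if inA Q (oneHot t) then μ t else 0) = 0 := by
        intro t
        rw [if_neg]
        intro hq
        have hf := hQ _ hq
        simp only [falsInd, decide_eq_true_eq] at hf
        have a1 := hf (vidx (i, t i)) true (by simp [vidx])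
        rw [oneHot_vidx] at a1
        simp at a1
      simp only [this, sum_const_zero, abs_zero]
      exact hlam
  induction π with
  | leaf f =>
    intro Q hQ
    obtain ⟨c, hc, rfl⟩ := hπ
    simpa [SemProof.length] using hax c hc Q hQ
  | node1 f s ih =>
    intro Q hQ
    have hs : 0 ≤ (s.length : ℝ) * lam := by positivity
    obtain ⟨h1 | h1, h2⟩ := hπ
    · obtain ⟨c, hc, rfl⟩ := h1
      have := hax c hc Q hQ
      simp only [SemProof.length]; push_cast; linarith
    · have := ih h2 Q (fun α hα => h1.2 α (hQ α hα))
      simp only [SemProof.length]; push_cast; linarith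
  | node2 f s t ihs iht =>
    intro Q hQ
    have hs : 0 ≤ (s.length : ℝ) * lam := by positivity
    have ht : 0 ≤ (t.length : ℝ) * lam := by positivity
    obtain ⟨h1 | h1, h2, h3⟩ := hπ
    · obtain ⟨c, hc, rfl⟩ := h1
      have := hax c hc Q hQ
      simp only [SemProof.length]; push_cast; linarith
    · obtain ⟨B, hB⟩ := root_affine h2
      obtain ⟨C, hC⟩ := root_affine h3
      have hcov : ∀ α, inA Q α → inA B α ∨ inA C α := by
        intro α hα
        rw [← hB, ← hC]
        exact h1.2 α (hQ α hα)
      simp only [SemProof.length]; push_cast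
      rcases cover_split Q B C hcov with hc | hc | ⟨q, hq1, hq2⟩
      · have := ihs h2 Q (fun α hα => (hB α).2 (hc α hα))
        linarith
      · have := iht h3 Q (fun α hα => (hC α).2 (hc α hα))
        linarith
      · have e1 := ihs h2 _ (fun α hα => (hB α).2 (hq1 α hα))
        have e2 := iht h3 _ (fun α hα => (hC α).2 (hq2 α hα))
        have : ∀ t : Tup k n, (if inA Q (oneHot t) then μ t else 0) =
            (if inA ((q.1, q.2 + 1) :: Q) (oneHot t) then μ t else 0) +
            (if inA (q :: Q) (oneHot t) then μ t else 0) := by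
          intro t
          have i1 : inA ((q.1, q.2 + 1) :: Q) (oneHot t) ↔
            lf q.1 (oneHot t) = q.2 + 1 ∧ inA Q (oneHot t) := by simp [inA]
          have i2 : inA (q :: Q) (oneHot t) ↔
            lf q.1 (oneHot t) = q.2 ∧ inA Q (oneHot t) := by simp [inA]
          have hne : ∀ x : ZMod 2, ¬ x = x + 1 := by decide
          by_cases hq : inA Q (oneHot t)
          · by_cases hl : lf q.1 (oneHot t) = q.2
            · simp [i1, i2, hq, hl]
            · simp [i1, i2, hq, hl, zmod2_ne.1 hl]
          · simp [i1, i2, hq]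
        simp only [this, sum_add_distrib]
        calc _ ≤ _ := abs_add_le _ _
          _ ≤ _ := add_le_add e1 e2
          _ ≤ _ := by linarith

open Classical in
theorem reduction' (G : Finset (Sym2 (Vtx k n))) (μ : Tup k n → ℝ) (lam : ℝ) (hlam : 0 ≤ lam)
    (h : ∀ u v : Vtx k n, u.1 < v.1 → s(u, v) ∉ G → ∀ g : Fin k → Fin n → ℝ,
      (∀ i x, g i x = 1 ∨ g i x = -1) →
      |∑ t, (if t u.1 = u.2 ∧ t v.1 = v.2 then μ t else 0) * ∏ i, g i (t i)| ≤ lam)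
    (π : SemProof (k * n)) (hπ : IsRefutation (ResLinLines (k * n)) (bcliqueU k n G) π) :
    |∑ t, μ t| ≤ π.length * lam := by
  have := reduction G μ lam hlam (by
    intro u v huv hG g hg
    rcases lt_or_gt_of_ne huv with h1 | h1
    · exact h u v h1 hG g hg
    · have := h v u h1 (by rwa [Sym2.eq_swap]) g hg
      simpa only [and_comm] using this) π hπ.1 [] (fun α _ => hπ.2 α)
  simpa [inA] using this

end Reduction

/-! ### The truncated clique polynomial -/

/-- The truncated clique polynomial, by recursion over a list of pairs of blocks. -/
noncomputable def pp {k : ℕ} (d : ℕ) (X : Fin k × Fin k → ℝ) :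
    List (Fin k × Fin k) → Finset (Fin k) → ℝ
  | [], U => if U.card ≤ 2 * d then 1 else 0
  | e :: L, U => if e.1 ∈ U ∨ e.2 ∈ U then (1 + X e) * pp d X L U
      else pp d X L U + X e * pp d X L (insert e.1 (insert e.2 U))

/-- A product term. -/
noncomputable def tm {k : ℕ} (τ : Fin k × Fin k → Fin 3) (X : Fin k × Fin k → ℝ) : ℝ :=
  ∏ e, if τ e = 1 then X e else if τ e = 2 then 1 + X e else 1

theorem tm_update_one {k : ℕ} (τ : Fin k × Fin k → Fin 3) (X : Fin k × Fin k → ℝ)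
    (e : Fin k × Fin k) (he : τ e = 0) :
    tm (Function.update τ e 1) X = X e * tm τ X := by
  unfold tm
  rw [← Finset.mul_prod_erase univ _ (mem_univ e),
    ← Finset.mul_prod_erase univ (fun e => if τ e = 1 then X e else if τ e = 2 then 1 + X e else 1)
      (mem_univ e)]
  have : ∏ x ∈ univ.erase e, (if Function.update τ e 1 x = 1 then X x else
      if Function.update τ e 1 x = 2 then 1 + X x else 1) =
      ∏ x ∈ univ.erase e, (if τ x = 1 then X x else if τ x = 2 then 1 + X x else 1) := by
    apply Finset.prod_congr rfl
    intro x hx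
    rw [Function.update_of_ne (Finset.ne_of_mem_erase hx)]
  rw [this]
  simp [he]

theorem tm_update_two {k : ℕ} (τ : Fin k × Fin k → Fin 3) (X : Fin k × Fin k → ℝ)
    (e : Fin k × Fin k) (he : τ e = 0) :
    tm (Function.update τ e 2) X = (1 + X e) * tm τ X := by
  unfold tm
  rw [← Finset.mul_prod_erase univ _ (mem_univ e),
    ← Finset.mul_prod_erase univ (fun e => if τ e = 1 then X e else if τ e = 2 then 1 + X e else 1)
      (mem_univ e)]
  have : ∏ x ∈ univ.erase e, (if Function.update τ e 2 x = 1 then X x else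
      if Function.update τ e 2 x = 2 then 1 + X x else 1) =
      ∏ x ∈ univ.erase e, (if τ x = 1 then X x else if τ x = 2 then 1 + X x else 1) := by
    apply Finset.prod_congr rfl
    intro x hx
    rw [Function.update_of_ne (Finset.ne_of_mem_erase hx)]
  rw [this]
  simp [he]

theorem tm_zero {k : ℕ} (X : Fin k × Fin k → ℝ) : tm (fun _ => 0) X = 1 := by
  simp [tm]

theorem pp_eq_zero {k d : ℕ} (X : Fin k × Fin k → ℝ) (L : List (Fin k × Fin k)) :
    ∀ U : Finset (Fin k), 2 * d < U.card → pp d X L U = 0 := by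
  induction L with
  | nil => intro U hU; simp [pp, hU]
  | cons e L ih =>
    intro U hU
    have h2 : 2 * d < (insert e.1 (insert e.2 U)).card :=
      lt_of_lt_of_le hU (Finset.card_le_card ((Finset.subset_insert _ _).trans
        (Finset.subset_insert _ _)))
    simp [pp, ih U hU, ih _ h2]

/-- The vertices of a set of pairs. -/
def vv {k : ℕ} (N : Finset (Fin k × Fin k)) : Finset (Fin k) :=
  N.biUnion fun e => {e.1, e.2}

/-- `N` is a matching. -/
def Mat {k : ℕ} (N : Finset (Fin k × Fin k)) : Prop :=
  (∀ e ∈ N, ∀ e' ∈ N, e ≠ e' → Disjoint ({e.1, e.2} : Finset (Fin k)) {e'.1, e'.2})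

theorem Mat.insert {k : ℕ} {N : Finset (Fin k × Fin k)} (h : Mat N) {U : Finset (Fin k)}
    (hU : vv N ⊆ U) {e : Fin k × Fin k} (h1 : e.1 ∉ U) (h2 : e.2 ∉ U) : Mat (insert e N) := by
  have key : ∀ e' ∈ N, Disjoint ({e.1, e.2} : Finset (Fin k)) {e'.1, e'.2} := by
    intro e' he'
    have a1 : e'.1 ∈ U := hU (by unfold vv; rw [mem_biUnion]; exact ⟨e', he', by simp⟩)
    have a2 : e'.2 ∈ U := hU (by unfold vv; rw [mem_biUnion]; exact ⟨e', he', by simp⟩)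
    rw [Finset.disjoint_left]
    intro x hx hx'
    simp only [mem_insert, mem_singleton] at hx hx'
    rcases hx with rfl | rfl <;> rcases hx' with h | h
    · exact h1 (h ▸ a1)
    · exact h1 (h ▸ a2)
    · exact h2 (h ▸ a1)
    · exact h2 (h ▸ a2)
  intro a ha b hb hab
  rw [mem_insert] at ha hb
  rcases ha with rfl | ha <;> rcases hb with rfl | hb
  · exact absurd rfl hab
  · exact key _ hb
  · exact (key _ ha).symm
  · exact h a ha b hb hab

theorem vv_insert {k : ℕ} (N : Finset (Fin k × Fin k)) (e : Fin k × Fin k) :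
    vv (insert e N) = insert e.1 (insert e.2 (vv N)) := by
  unfold vv
  rw [Finset.biUnion_insert]
  ext x; simp

theorem notMem_of_vv {k : ℕ} {N : Finset (Fin k × Fin k)} {U : Finset (Fin k)}
    (hU : vv N ⊆ U) {e : Fin k × Fin k} (h1 : e.1 ∉ U) : e ∉ N := by
  intro he
  exact h1 (hU (by unfold vv; rw [mem_biUnion]; exact ⟨e, he, by simp⟩))

/-- admissible data for a product term -/
structure Adm {k : ℕ} (τ : Fin k × Fin k → Fin 3) (W : Finset (Fin k))
    (N : Finset (Fin k × Fin k)) : Prop where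
  mat : Mat N
  one : ∀ e ∈ N, τ e = 1
  lt : ∀ e, τ e ≠ 0 → e.1 < e.2
  ins : ∀ e, τ e = 1 → e.1 ∈ W ∧ e.2 ∈ W
  tch : ∀ e, τ e = 2 → e.1 ∈ W ∨ e.2 ∈ W

theorem Adm.two {k : ℕ} {τ : Fin k × Fin k → Fin 3} {W : Finset (Fin k)}
    {N : Finset (Fin k × Fin k)} (h : Adm τ W N) {e : Fin k × Fin k} (he : τ e = 0)
    (hlt : e.1 < e.2) (ht : e.1 ∈ W ∨ e.2 ∈ W) : Adm (Function.update τ e 2) W N := by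
  have hN : ∀ a ∈ N, a ≠ e := by
    rintro a ha rfl
    have := h.one a ha
    rw [he] at this; exact absurd this (by decide)
  refine ⟨h.mat, fun a ha => ?_, fun a ha => ?_, fun a ha => ?_, fun a ha => ?_⟩
  · rw [Function.update_of_ne (hN a ha)]; exact h.one a ha
  · by_cases hae : a = e
    · subst hae; exact hlt
    · rw [Function.update_of_ne hae] at ha; exact h.lt a ha
  · by_cases hae : a = e
    · subst hae; simp at ha
    · rw [Function.update_of_ne hae] at ha; exact h.ins a ha
  · by_cases hae : a = e
    · subst hae; exact ht
    · rw [Function.update_of_ne hae] at ha; exact h.tch a ha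

theorem Adm.mono {k : ℕ} {τ : Fin k × Fin k → Fin 3} {W W' : Finset (Fin k)}
    {N : Finset (Fin k × Fin k)} (h : Adm τ W N) (hW : W ⊆ W') : Adm τ W' N :=
  ⟨h.mat, h.one, h.lt, fun e he => ⟨hW (h.ins e he).1, hW (h.ins e he).2⟩,
    fun e he => (h.tch e he).imp (fun x => hW x) (fun x => hW x)⟩

/-- Adding an edge to the `X` part. -/
theorem Adm.oneX {k : ℕ} {τ : Fin k × Fin k → Fin 3} {W : Finset (Fin k)}
    {N : Finset (Fin k × Fin k)} (h : Adm τ W N) {e : Fin k × Fin k} (he : τ e = 0)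
    (hlt : e.1 < e.2) (h1 : e.1 ∈ W) (h2 : e.2 ∈ W) : Adm (Function.update τ e 1) W N := by
  have hN : ∀ a ∈ N, a ≠ e := by
    rintro a ha rfl
    have := h.one a ha
    rw [he] at this; exact absurd this (by decide)
  refine ⟨h.mat, fun a ha => ?_, fun a ha => ?_, fun a ha => ?_, fun a ha => ?_⟩
  · rw [Function.update_of_ne (hN a ha)]; exact h.one a ha
  · by_cases hae : a = e
    · subst hae; exact hlt
    · rw [Function.update_of_ne hae] at ha; exact h.lt a ha
  · by_cases hae : a = e
    · subst hae; exact ⟨h1, h2⟩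
    · rw [Function.update_of_ne hae] at ha; exact h.ins a ha
  · by_cases hae : a = e
    · subst hae; simp at ha
    · rw [Function.update_of_ne hae] at ha; exact h.tch a ha

theorem Adm.oneN {k : ℕ} {τ : Fin k × Fin k → Fin 3} {W : Finset (Fin k)}
    {N : Finset (Fin k × Fin k)} (h : Adm τ W N) {e : Fin k × Fin k} (he : τ e = 1)
    (hm : Mat (insert e N)) : Adm τ W (insert e N) := by
  refine ⟨hm, fun a ha => ?_, h.lt, h.ins, h.tch⟩
  rw [mem_insert] at ha
  rcases ha with rfl | ha
  · exact he
  · exact h.one a ha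

theorem card_ins2 {k : ℕ} {e : Fin k × Fin k} (hlt : e.1 < e.2) {U : Finset (Fin k)}
    (h1 : e.1 ∉ U) (h2 : e.2 ∉ U) : (insert e.1 (insert e.2 U)).card = U.card + 2 := by
  rw [card_insert_of_notMem, card_insert_of_notMem h2]
  simp [h1, hlt.ne]

/-- The weight function used for counting leaves. -/
noncomputable def bb (d : ℕ) (R : ℝ) (S : ℕ) : ℝ := if S ≤ 4 * d + 4 then R ^ (4 * d + 4 - S) else 0

theorem bb_nonneg {d : ℕ} {R : ℝ} (hR : 1 ≤ R) (S : ℕ) : 0 ≤ bb d R S := by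
  unfold bb; split_ifs
  · positivity
  · exact le_rfl

theorem bb_step {d : ℕ} {R : ℝ} (hR : 1 ≤ R) {S S' : ℕ} (h : S + 2 ≤ S') :
    bb d R S' ≤ bb d R S * (1 / R ^ 2) := by
  unfold bb
  have hR0 : 0 < R := by linarith
  split_ifs with h1 h2 h2
  · rw [mul_one_div, le_div_iff₀ (by positivity), ← pow_add]
    exact pow_le_pow_right₀ hR (by omega)
  · omega
  · positivity
  · simp

theorem bb_anti {d : ℕ} {R : ℝ} (hR : 1 ≤ R) {S S' : ℕ} (h : S ≤ S') :
    bb d R S' ≤ bb d R S := by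
  unfold bb
  have hR0 : 0 < R := by linarith
  split_ifs with h1 h2 h2
  · exact pow_le_pow_right₀ hR (by omega)
  · omega
  · positivity
  · simp

section Resid

variable {k : ℕ} {T : Type*} [Fintype T] (w : T → ℝ) (X : T → Fin k × Fin k → ℝ) (d : ℕ) (lam : ℝ)

theorem sd_card_le {U U' : Finset (Fin k)} (h : (U \ U').card + (U' \ U).card ≤ 2) :
    U.card ≤ U'.card + 2 ∧ U'.card ≤ U.card + 2 ∧ (U ∪ U').card ≤ U.card + 2 ∧
      (U ∪ U').card ≤ U'.card + 2 := by
  have h1 := Finset.card_sdiff_add_card_inter U U'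
  have h2 := Finset.card_sdiff_add_card_inter U' U
  have h3 := Finset.card_union_add_card_inter U U'
  rw [Finset.inter_comm] at h2
  omega

/-- One-sided extension does not increase the symmetric difference. -/
theorem sd_one {U U' : Finset (Fin k)} (h : (U \ U').card + (U' \ U).card ≤ 2)
    {e : Fin k × Fin k} (hlt : e.1 < e.2) (ht : e.1 ∈ U ∨ e.2 ∈ U) (h1 : e.1 ∉ U') (h2 : e.2 ∉ U') :
    (U \ insert e.1 (insert e.2 U')).card + (insert e.1 (insert e.2 U') \ U).card ≤ 2 := by
  have hA : U \ insert e.1 (insert e.2 U') = ((U \ U').erase e.1).erase e.2 := by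
    ext x; simp; tauto
  by_cases c1 : e.1 ∈ U
  · by_cases c2 : e.2 ∈ U
    · have hB : insert e.1 (insert e.2 U') \ U = U' \ U := by
        ext x; simp only [mem_sdiff, mem_insert]
        constructor
        · rintro ⟨rfl | rfl | h, h'⟩
          · exact absurd c1 h'
          · exact absurd c2 h'
          · exact ⟨h, h'⟩
        · rintro ⟨h, h'⟩; exact ⟨Or.inr (Or.inr h), h'⟩
      rw [hA, hB]
      have := Finset.card_le_card ((Finset.erase_subset e.2 ((U \ U').erase e.1)).trans
        (Finset.erase_subset e.1 (U \ U')))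
      omega
    · have hB : insert e.1 (insert e.2 U') \ U ⊆ insert e.2 (U' \ U) := by
        intro x; simp only [mem_sdiff, mem_insert]
        rintro ⟨rfl | rfl | h, h'⟩
        · exact absurd c1 h'
        · exact Or.inl rfl
        · exact Or.inr ⟨h, h'⟩
      have hB' := (Finset.card_le_card hB).trans (Finset.card_insert_le _ _)
      have hc : ((U \ U').erase e.1).card + 1 = (U \ U').card :=
        Finset.card_erase_add_one (by simp [c1, h1])
      have hA' := Finset.card_le_card (Finset.erase_subset e.2 ((U \ U').erase e.1))
      rw [hA]; omega
  · have c2 : e.2 ∈ U := by tauto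
    have hB : insert e.1 (insert e.2 U') \ U ⊆ insert e.1 (U' \ U) := by
      intro x; simp only [mem_sdiff, mem_insert]
      rintro ⟨rfl | rfl | h, h'⟩
      · exact Or.inl rfl
      · exact absurd c2 h'
      · exact Or.inr ⟨h, h'⟩
    have hB' := (Finset.card_le_card hB).trans (Finset.card_insert_le _ _)
    have hc : ((U \ U').erase e.2).card + 1 = (U \ U').card :=
      Finset.card_erase_add_one (by simp [c2, h2])
    have hA' := Finset.card_le_card (Finset.erase_subset e.1 ((U \ U').erase e.2))
    rw [hA, Finset.erase_right_comm]; omega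

theorem sd_two {U U' : Finset (Fin k)} (h : (U \ U').card + (U' \ U).card ≤ 2)
    (e : Fin k × Fin k) :
    (insert e.1 (insert e.2 U) \ insert e.1 (insert e.2 U')).card +
      (insert e.1 (insert e.2 U') \ insert e.1 (insert e.2 U)).card ≤ 2 := by
  have a : insert e.1 (insert e.2 U) \ insert e.1 (insert e.2 U') ⊆ U \ U' := by
    intro x; simp only [mem_sdiff, mem_insert]; tauto
  have b : insert e.1 (insert e.2 U') \ insert e.1 (insert e.2 U) ⊆ U' \ U := by
    intro x; simp only [mem_sdiff, mem_insert]; tauto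
  have := Finset.card_le_card a
  have := Finset.card_le_card b
  omega

theorem pair_bound (hlam : 0 ≤ lam) {R : ℝ} (hR : 1 ≤ R)
    (H : ∀ τ W N, Adm τ W N → W.card ≤ 2 * d + 2 → d ≤ N.card + 1 →
      |∑ t, w t * tm τ (X t)| ≤ lam) (L : List (Fin k × Fin k)) :
    ∀ (τ : Fin k × Fin k → Fin 3) (U U' : Finset (Fin k)) (N : Finset (Fin k × Fin k)),
      L.Nodup → (∀ e ∈ L, e.1 < e.2) → (∀ e ∈ L, τ e = 0) →
      (U \ U').card + (U' \ U).card ≤ 2 → Adm τ (U ∪ U') N → vv N ⊆ U → U.card ≤ 2 * N.card + 2 →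
      |∑ t, w t * (tm τ (X t) * (pp d (X t) L U - pp d (X t) L U'))| ≤
        lam * bb d R (U.card + U'.card) * (1 + 1 / R ^ 2) ^ L.length := by
  have hR0 : 0 < R := by linarith
  induction L with
  | nil =>
    intro τ U U' N _ _ _ hsd hA hN hc
    have hsd' := sd_card_le hsd
    simp only [pp, List.length_nil, pow_zero, mul_one]
    by_cases h1 : U.card ≤ 2 * d <;> by_cases h2 : U'.card ≤ 2 * d
    · simp only [h1, h2, if_true, sub_self, mul_zero, sum_const_zero, abs_zero]
      exact mul_nonneg hlam (bb_nonneg hR _)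
    · simp only [h1, h2, if_true, if_false, sub_zero, mul_one]
      refine (H τ _ N hA (by omega) (by omega)).trans ?_
      refine le_mul_of_one_le_right hlam ?_
      rw [bb, if_pos (by omega)]
      exact one_le_pow₀ hR
    · simp only [h1, h2, if_true, if_false, zero_sub, mul_neg, mul_one, sum_neg_distrib, abs_neg]
      refine (H τ _ N hA (by omega) (by omega)).trans ?_
      refine le_mul_of_one_le_right hlam ?_
      rw [bb, if_pos (by omega)]
      exact one_le_pow₀ hR
    · simp only [h1, h2, if_false, sub_self, mul_zero, sum_const_zero, abs_zero]
      exact mul_nonneg hlam (bb_nonneg hR _)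
  | cons e L ih =>
    intro τ U U' N hnd hlt hτ hsd hA hN hc
    have hnd' := (List.nodup_cons.1 hnd)
    have hlt' : ∀ e ∈ L, e.1 < e.2 := fun a ha => hlt a (List.mem_cons_of_mem _ ha)
    have hτ' : ∀ e ∈ L, τ e = 0 := fun a ha => hτ a (List.mem_cons_of_mem _ ha)
    have he : e.1 < e.2 := hlt e List.mem_cons_self
    have hτe : τ e = 0 := hτ e List.mem_cons_self
    have hτu : ∀ c, ∀ a ∈ L, Function.update τ e c a = 0 := by
      intro c a ha
      rw [Function.update_of_ne (by rintro rfl; exact hnd'.1 ha)]; exact hτ' a ha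
    -- combine two bounds
    have comb : ∀ {a b : ℝ} {S : ℕ}, U.card + U'.card + 2 ≤ S →
        |a| ≤ lam * bb d R (U.card + U'.card) * (1 + 1 / R ^ 2) ^ L.length →
        |b| ≤ lam * bb d R S * (1 + 1 / R ^ 2) ^ L.length →
        |a + b| ≤ lam * bb d R (U.card + U'.card) * (1 + 1 / R ^ 2) ^ (e :: L).length := by
      intro a b S hS ha hb
      have h3 := bb_step (d := d) hR hS
      have h4 : lam * bb d R S * (1 + 1 / R ^ 2) ^ L.length ≤
          lam * (bb d R (U.card + U'.card) * (1 / R ^ 2)) * (1 + 1 / R ^ 2) ^ L.length := by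
        gcongr
      rw [List.length_cons, pow_succ]
      calc |a + b| ≤ |a| + |b| := abs_add_le _ _
        _ ≤ _ := add_le_add ha (hb.trans h4)
        _ = _ := by ring
    have h0 := ih τ U U' N hnd'.2 hlt' hτ' hsd hA hN hc
    by_cases c1 : e.1 ∈ U ∨ e.2 ∈ U <;> by_cases c2 : e.1 ∈ U' ∨ e.2 ∈ U'
    · have h2 := ih (Function.update τ e 2) U U' N hnd'.2 hlt' (hτu 2) hsd
        (hA.two hτe he (by simp only [mem_union]; tauto)) hN hc
      have : ∀ t, w t * (tm τ (X t) * (pp d (X t) (e :: L) U - pp d (X t) (e :: L) U')) =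
          w t * (tm (Function.update τ e 2) (X t) * (pp d (X t) L U - pp d (X t) L U')) := by
        intro t
        rw [tm_update_two _ _ _ hτe]
        simp only [pp, c1, c2, if_true]; ring
      simp only [this]
      refine h2.trans ?_
      rw [List.length_cons]
      have hb := bb_nonneg (d := d) hR (U.card + U'.card)
      have : 0 ≤ 1 / R ^ 2 := by positivity
      gcongr
      · linarith
      · omega
    · have c2' := not_or.1 c2
      have hcard := card_ins2 he c2'.1 c2'.2
      have hA' : Adm τ (U ∪ insert e.1 (insert e.2 U')) N := hA.mono (by
        intro x; simp only [mem_union, mem_insert]; tauto)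
      have h2 := ih (Function.update τ e 1) U (insert e.1 (insert e.2 U')) N hnd'.2 hlt' (hτu 1)
        (sd_one hsd he c1 c2'.1 c2'.2) (hA'.oneX hτe he (by simp) (by simp)) hN hc
      have : ∀ t, w t * (tm τ (X t) * (pp d (X t) (e :: L) U - pp d (X t) (e :: L) U')) =
          w t * (tm τ (X t) * (pp d (X t) L U - pp d (X t) L U')) +
          w t * (tm (Function.update τ e 1) (X t) *
            (pp d (X t) L U - pp d (X t) L (insert e.1 (insert e.2 U')))) := by
        intro t
        rw [tm_update_one _ _ _ hτe]
        simp only [pp, c1, c2, if_true, if_false]; ring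
      simp only [this, sum_add_distrib]
      exact comb (by omega) h0 h2
    · have c1' := not_or.1 c1
      have hcard := card_ins2 he c1'.1 c1'.2
      have hA' : Adm τ (insert e.1 (insert e.2 U) ∪ U') N := hA.mono (by
        intro x; simp only [mem_union, mem_insert]; tauto)
      have hA2 := (hA'.oneX hτe he (by simp) (by simp)).oneN (e := e) (by simp)
        (hA.mat.insert hN c1'.1 c1'.2)
      have hNc : (insert e N).card = N.card + 1 := card_insert_of_notMem (notMem_of_vv hN c1'.1)
      have hsd1 := sd_one (U := U') (U' := U) (by omega) he c2 c1'.1 c1'.2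
      have h2 := ih (Function.update τ e 1) (insert e.1 (insert e.2 U)) U' (insert e N)
        hnd'.2 hlt' (hτu 1) (by omega) hA2
        (by rw [vv_insert]; exact insert_subset_insert _ (insert_subset_insert _ hN)) (by omega)
      have : ∀ t, w t * (tm τ (X t) * (pp d (X t) (e :: L) U - pp d (X t) (e :: L) U')) =
          w t * (tm τ (X t) * (pp d (X t) L U - pp d (X t) L U')) +
          w t * (tm (Function.update τ e 1) (X t) *
            (pp d (X t) L (insert e.1 (insert e.2 U)) - pp d (X t) L U')) := by
        intro t
        rw [tm_update_one _ _ _ hτe]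
        simp only [pp, c1, c2, if_true, if_false]; ring
      simp only [this, sum_add_distrib]
      exact comb (by omega) h0 h2
    · have c1' := not_or.1 c1
      have c2' := not_or.1 c2
      have hcard := card_ins2 he c1'.1 c1'.2
      have hcard' := card_ins2 he c2'.1 c2'.2
      have hA' : Adm τ (insert e.1 (insert e.2 U) ∪ insert e.1 (insert e.2 U')) N := hA.mono (by
        intro x; simp only [mem_union, mem_insert]; tauto)
      have hA2 := (hA'.oneX hτe he (by simp) (by simp)).oneN (e := e) (by simp)
        (hA.mat.insert hN c1'.1 c1'.2)
      have hNc : (insert e N).card = N.card + 1 := card_insert_of_notMem (notMem_of_vv hN c1'.1)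
      have h2 := ih (Function.update τ e 1) (insert e.1 (insert e.2 U)) (insert e.1 (insert e.2 U'))
        (insert e N) hnd'.2 hlt' (hτu 1) (sd_two hsd e) hA2
        (by rw [vv_insert]; exact insert_subset_insert _ (insert_subset_insert _ hN)) (by omega)
      have : ∀ t, w t * (tm τ (X t) * (pp d (X t) (e :: L) U - pp d (X t) (e :: L) U')) =
          w t * (tm τ (X t) * (pp d (X t) L U - pp d (X t) L U')) +
          w t * (tm (Function.update τ e 1) (X t) *
            (pp d (X t) L (insert e.1 (insert e.2 U)) -
              pp d (X t) L (insert e.1 (insert e.2 U')))) := by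
        intro t
        rw [tm_update_one _ _ _ hτe]
        simp only [pp, c1, c2, if_false]; ring
      simp only [this, sum_add_distrib]
      exact comb (by omega) h0 h2

theorem single_bound (hlam : 0 ≤ lam) {R : ℝ} (hR : 1 ≤ R)
    (H : ∀ τ W N, Adm τ W N → W.card ≤ 2 * d + 2 → d ≤ N.card + 1 →
      |∑ t, w t * tm τ (X t)| ≤ lam) (f : Fin k × Fin k) (hf : ∀ t, w t = 0 ∨ X t f = -1)
    (L : List (Fin k × Fin k)) :
    ∀ (τ : Fin k × Fin k → Fin 3) (U : Finset (Fin k)) (N : Finset (Fin k × Fin k)),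
      L.Nodup → (∀ e ∈ L, e.1 < e.2) → (∀ e ∈ L, τ e = 0) → f ∈ L →
      Adm τ U N → vv N ⊆ U → U.card ≤ 2 * N.card →
      |∑ t, w t * (tm τ (X t) * pp d (X t) L U)| ≤
        lam * bb d R (2 * U.card) * (1 + 1 / R ^ 2) ^ L.length := by
  have hR0 : 0 < R := by linarith
  have hR2 : 0 ≤ 1 / R ^ 2 := by positivity
  induction L with
  | nil => intro τ U N _ _ _ h; simp at h
  | cons e L ih =>
    intro τ U N hnd hlt hτ hfL hA hN hc
    have hnd' := (List.nodup_cons.1 hnd)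
    have hlt' : ∀ e ∈ L, e.1 < e.2 := fun a ha => hlt a (List.mem_cons_of_mem _ ha)
    have hτ' : ∀ e ∈ L, τ e = 0 := fun a ha => hτ a (List.mem_cons_of_mem _ ha)
    have he : e.1 < e.2 := hlt e List.mem_cons_self
    have hτe : τ e = 0 := hτ e List.mem_cons_self
    have hτu : ∀ c, ∀ a ∈ L, Function.update τ e c a = 0 := by
      intro c a ha
      rw [Function.update_of_ne (by rintro rfl; exact hnd'.1 ha)]; exact hτ' a ha
    have hbn := bb_nonneg (d := d) hR (2 * U.card)
    by_cases hfe : f = e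
    · subst hfe
      by_cases c1 : f.1 ∈ U ∨ f.2 ∈ U
      · have : ∀ t, w t * (tm τ (X t) * pp d (X t) (f :: L) U) = 0 := by
          intro t
          rcases hf t with h | h
          · simp [h]
          · simp [pp, c1, h]
        simp only [this, sum_const_zero, abs_zero]
        positivity
      · have c1' := not_or.1 c1
        have hcard := card_ins2 he c1'.1 c1'.2
        have : ∀ t, w t * (tm τ (X t) * pp d (X t) (f :: L) U) =
            w t * (tm τ (X t) * (pp d (X t) L U - pp d (X t) L (insert f.1 (insert f.2 U)))) := by
          intro t
          rcases hf t with h | h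
          · simp [h]
          · simp only [pp, c1, h, if_false]; ring
        simp only [this]
        have hs : (U \ insert f.1 (insert f.2 U)).card + (insert f.1 (insert f.2 U) \ U).card ≤ 2 := by
          have a : U \ insert f.1 (insert f.2 U) = ∅ := by
            ext x; simp; tauto
          have b : insert f.1 (insert f.2 U) \ U ⊆ {f.1, f.2} := by
            intro x; simp only [mem_sdiff, mem_insert, mem_singleton]; tauto
          have := (card_le_card b).trans card_le_two
          rw [a]; simpa using this
        have h := pair_bound w X d lam hlam hR H L τ U (insert f.1 (insert f.2 U)) N hnd'.2 hlt' hτ'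
          hs (hA.mono subset_union_left) hN (by omega)
        refine h.trans ?_
        rw [List.length_cons]
        have := bb_anti (d := d) hR (S := 2 * U.card)
          (S' := U.card + (insert f.1 (insert f.2 U)).card) (by omega)
        gcongr
        · linarith
        · omega
    · have hfL' : f ∈ L := by
        rcases List.mem_cons.1 hfL with h | h
        · exact absurd h hfe
        · exact h
      by_cases c1 : e.1 ∈ U ∨ e.2 ∈ U
      · have h2 := ih (Function.update τ e 2) U N hnd'.2 hlt' (hτu 2) hfL' (hA.two hτe he c1) hN hc
        have : ∀ t, w t * (tm τ (X t) * pp d (X t) (e :: L) U) =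
            w t * (tm (Function.update τ e 2) (X t) * pp d (X t) L U) := by
          intro t
          rw [tm_update_two _ _ _ hτe]
          simp only [pp, c1, if_true]; ring
        simp only [this]
        refine h2.trans ?_
        rw [List.length_cons]
        gcongr
        · linarith
        · omega
      · have c1' := not_or.1 c1
        have hcard := card_ins2 he c1'.1 c1'.2
        have hA' : Adm τ (insert e.1 (insert e.2 U)) N := hA.mono (by
          intro x; simp only [mem_insert]; tauto)
        have hA2 := (hA'.oneX hτe he (by simp) (by simp)).oneN (e := e) (by simp)
          (hA.mat.insert hN c1'.1 c1'.2)
        have hNc : (insert e N).card = N.card + 1 := card_insert_of_notMem (notMem_of_vv hN c1'.1)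
        have h0 := ih τ U N hnd'.2 hlt' hτ' hfL' hA hN hc
        have h2 := ih (Function.update τ e 1) (insert e.1 (insert e.2 U))
          (insert e N) hnd'.2 hlt' (hτu 1) hfL' hA2
          (by rw [vv_insert]; exact insert_subset_insert _ (insert_subset_insert _ hN)) (by omega)
        have : ∀ t, w t * (tm τ (X t) * pp d (X t) (e :: L) U) =
            w t * (tm τ (X t) * pp d (X t) L U) +
            w t * (tm (Function.update τ e 1) (X t) *
              pp d (X t) L (insert e.1 (insert e.2 U))) := by
          intro t
          rw [tm_update_one _ _ _ hτe]
          simp only [pp, c1, if_false]; ring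
        simp only [this, sum_add_distrib]
        have h3 := bb_step (d := d) hR (S := 2 * U.card)
          (S' := 2 * (insert e.1 (insert e.2 U)).card) (by omega)
        have h4 : lam * bb d R (2 * (insert e.1 (insert e.2 U)).card) * (1 + 1 / R ^ 2) ^ L.length ≤
            lam * (bb d R (2 * U.card) * (1 / R ^ 2)) * (1 + 1 / R ^ 2) ^ L.length := by
          gcongr
        rw [List.length_cons, pow_succ]
        calc _ ≤ _ := abs_add_le _ _
          _ ≤ _ := add_le_add h0 (h2.trans h4)
          _ = _ := by ring

theorem mass_bound {C θ : ℝ} (hC : 0 ≤ C) (hθ : 0 ≤ θ)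
    (H : ∀ τ W N, Adm τ W N → W.card ≤ 2 * d → W.card = 2 * N.card →
      |∑ t, w t * tm τ (X t)| ≤ C * θ ^ N.card)
    (L : List (Fin k × Fin k)) :
    ∀ (τ : Fin k × Fin k → Fin 3) (U : Finset (Fin k)) (N : Finset (Fin k × Fin k)),
      L.Nodup → (∀ e ∈ L, e.1 < e.2) → (∀ e ∈ L, τ e = 0) →
      Adm τ U N → vv N ⊆ U → U.card = 2 * N.card →
      |∑ t, w t * (tm τ (X t) * pp d (X t) L U)| ≤
        C * θ ^ N.card * (1 + θ) ^ L.length := by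
  induction L with
  | nil =>
    intro τ U N _ _ _ hA _ hc
    by_cases h : U.card ≤ 2 * d
    · simpa [pp, h] using H τ U N hA h hc
    · simp only [pp, h, if_false, mul_zero, sum_const_zero, abs_zero]
      positivity
  | cons e L ih =>
    intro τ U N hnd hlt hτ hA hN hc
    have hnd' := (List.nodup_cons.1 hnd)
    have hlt' : ∀ e ∈ L, e.1 < e.2 := fun a ha => hlt a (List.mem_cons_of_mem _ ha)
    have hτ' : ∀ e ∈ L, τ e = 0 := fun a ha => hτ a (List.mem_cons_of_mem _ ha)
    have he : e.1 < e.2 := hlt e List.mem_cons_self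
    have hτe : τ e = 0 := hτ e List.mem_cons_self
    have hτu : ∀ c, ∀ a ∈ L, Function.update τ e c a = 0 := by
      intro c a ha
      rw [Function.update_of_ne (by rintro rfl; exact hnd'.1 ha)]; exact hτ' a ha
    by_cases c1 : e.1 ∈ U ∨ e.2 ∈ U
    · have h2 := ih (Function.update τ e 2) U N hnd'.2 hlt' (hτu 2) (hA.two hτe he c1) hN hc
      have : ∀ t, w t * (tm τ (X t) * pp d (X t) (e :: L) U) =
          w t * (tm (Function.update τ e 2) (X t) * pp d (X t) L U) := by
        intro t
        rw [tm_update_two _ _ _ hτe]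
        simp only [pp, c1, if_true]; ring
      simp only [this]
      refine h2.trans ?_
      rw [List.length_cons]
      gcongr
      · linarith
      · omega
    · have c1' := not_or.1 c1
      have hcard := card_ins2 he c1'.1 c1'.2
      have hA' : Adm τ (insert e.1 (insert e.2 U)) N := hA.mono (by
        intro x; simp only [mem_insert]; tauto)
      have hA2 := (hA'.oneX hτe he (by simp) (by simp)).oneN (e := e) (by simp)
        (hA.mat.insert hN c1'.1 c1'.2)
      have hNc : (insert e N).card = N.card + 1 := card_insert_of_notMem (notMem_of_vv hN c1'.1)
      have h0 := ih τ U N hnd'.2 hlt' hτ' hA hN hc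
      have h2 := ih (Function.update τ e 1) (insert e.1 (insert e.2 U))
        (insert e N) hnd'.2 hlt' (hτu 1) hA2
        (by rw [vv_insert]; exact insert_subset_insert _ (insert_subset_insert _ hN)) (by omega)
      have : ∀ t, w t * (tm τ (X t) * pp d (X t) (e :: L) U) =
          w t * (tm τ (X t) * pp d (X t) L U) +
          w t * (tm (Function.update τ e 1) (X t) *
            pp d (X t) L (insert e.1 (insert e.2 U))) := by
        intro t
        rw [tm_update_one _ _ _ hτe]
        simp only [pp, c1, if_false]; ring
      simp only [this, sum_add_distrib]
      rw [hNc] at h2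
      rw [List.length_cons, pow_succ]
      calc _ ≤ _ := abs_add_le _ _
        _ ≤ _ := add_le_add h0 h2
        _ = _ := by ring

theorem adm_zero : Adm (k := k) (fun _ => 0) ∅ ∅ :=
  ⟨by intro e he; simp at he, by simp, by simp, by simp, by simp⟩

theorem mass_total {C θ : ℝ} (hC : 0 ≤ C) (hθ : 0 ≤ θ) (hw : ∑ t, w t = 1)
    (H : ∀ τ W N, Adm τ W N → W.card ≤ 2 * d → W.card = 2 * N.card →
      |∑ t, w t * tm τ (X t)| ≤ C * θ ^ N.card)
    (L : List (Fin k × Fin k)) (hnd : L.Nodup) (hlt : ∀ e ∈ L, e.1 < e.2) :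
      |∑ t, w t * pp d (X t) L ∅ - 1| ≤ L.length * (C * θ * (1 + θ) ^ L.length) := by
  induction L with
  | nil => simp [pp, hw]
  | cons e L ih =>
    have hnd' := (List.nodup_cons.1 hnd)
    have hlt' : ∀ e ∈ L, e.1 < e.2 := fun a ha => hlt a (List.mem_cons_of_mem _ ha)
    have he : e.1 < e.2 := hlt e List.mem_cons_self
    have h0 := ih hnd'.2 hlt'
    have hA' : Adm (fun _ => 0) (insert e.1 (insert e.2 (∅ : Finset (Fin k)))) ∅ :=
      adm_zero.mono (by simp)
    have hA2 := (hA'.oneX rfl he (by simp) (by simp)).oneN (e := e) (by simp)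
        (adm_zero.mat.insert (U := ∅) (by simp [vv]) (by simp) (by simp))
    have hcard := card_ins2 he (U := ∅) (by simp) (by simp)
    have h2 := mass_bound w X d hC hθ H L (Function.update (fun _ => 0) e 1)
      (insert e.1 (insert e.2 ∅)) (insert e ∅) hnd'.2 hlt' (by
        intro a ha
        rw [Function.update_of_ne (by rintro rfl; exact hnd'.1 ha)]) hA2
      (by rw [vv_insert]; simp [vv]) (by rw [hcard]; simp)
    have : ∀ t, w t * pp d (X t) (e :: L) ∅ = w t * pp d (X t) L ∅ +
        w t * (tm (Function.update (fun _ => 0) e 1) (X t) *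
          pp d (X t) L (insert e.1 (insert e.2 ∅))) := by
      intro t
      rw [tm_update_one _ _ _ rfl, tm_zero]
      simp [pp]; ring
    simp only [this, sum_add_distrib]
    have hx : C * θ * (1 + θ) ^ L.length ≤ C * θ * (1 + θ) ^ (L.length + 1) := by
      gcongr
      · linarith
      · omega
    simp only [insert_empty_eq, card_singleton, pow_one] at h2 h0 ⊢
    rw [List.length_cons]
    push_cast
    rw [add_sub_right_comm]
    calc _ ≤ _ := abs_add_le _ _
      _ ≤ _ := add_le_add h0 h2
      _ ≤ L.length * (C * θ * (1 + θ) ^ (L.length + 1)) + C * θ * (1 + θ) ^ (L.length + 1) := by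
          gcongr
      _ = _ := by ring

theorem resid_total (hlam : 0 ≤ lam) {R : ℝ} (hR : 1 ≤ R)
    (H : ∀ τ W N, Adm τ W N → W.card ≤ 2 * d + 2 → d ≤ N.card + 1 →
      |∑ t, w t * tm τ (X t)| ≤ lam) (f : Fin k × Fin k) (hf : ∀ t, w t = 0 ∨ X t f = -1)
    (L : List (Fin k × Fin k)) (hnd : L.Nodup) (hlt : ∀ e ∈ L, e.1 < e.2) (hfL : f ∈ L) :
      |∑ t, w t * pp d (X t) L ∅| ≤ lam * R ^ (4 * d + 4) * (1 + 1 / R ^ 2) ^ L.length := by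
  have := single_bound w X d lam hlam hR H f hf L (fun _ => 0) ∅ ∅ hnd hlt (by simp) hfL adm_zero
    (by simp [vv]) (by simp)
  simpa [tm_zero, bb] using this

end Resid

/-! ### Expectations over the random graph -/

set_option linter.unusedSectionVars false

section EXsec
variable {E : Type*} [DecidableEq E]

/-- Expectation over a random subset of `pot`, each element kept with probability `p`. -/
noncomputable def EX (pot : Finset E) (p : ℝ) (f : Finset E → ℝ) : ℝ :=
  ∑ G ∈ pot.powerset, p ^ G.card * (1 - p) ^ (pot.card - G.card) * f G

/-- The biased character of a single edge. -/
noncomputable def ch (p : ℝ) (G : Finset E) (e : E) : ℝ := if e ∈ G then (1 - p) / p else -1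

theorem EX_mono {pot : Finset E} {p : ℝ} (hp : 0 ≤ p) (hp1 : p ≤ 1) {f g : Finset E → ℝ}
    (h : ∀ G, f G ≤ g G) : EX pot p f ≤ EX pot p g := by
  refine sum_le_sum fun G _ => mul_le_mul_of_nonneg_left (h G) ?_
  have : 0 ≤ 1 - p := by linarith
  positivity

theorem EX_one (pot : Finset E) (p : ℝ) : EX pot p (fun _ => 1) = 1 := by
  unfold EX
  simp only [mul_one]
  rw [Finset.sum_pow_mul_eq_add_pow]
  simp

theorem EX_sum {ι : Type*} (s : Finset ι) (pot : Finset E) (p : ℝ) (f : ι → Finset E → ℝ) :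
    EX pot p (fun G => ∑ i ∈ s, f i G) = ∑ i ∈ s, EX pot p (f i) := by
  unfold EX
  rw [sum_comm]
  simp only [mul_sum]

theorem EX_add (pot : Finset E) (p : ℝ) (f g : Finset E → ℝ) :
    EX pot p (fun G => f G + g G) = EX pot p f + EX pot p g := by
  unfold EX
  rw [← sum_add_distrib]
  simp only [mul_add]

theorem EX_mul_left (pot : Finset E) (p c : ℝ) (f : Finset E → ℝ) :
    EX pot p (fun G => c * f G) = c * EX pot p f := by
  unfold EX
  rw [mul_sum]
  exact sum_congr rfl fun G _ => by ring

theorem EX_const (pot : Finset E) (p c : ℝ) : EX pot p (fun _ => c) = c := by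
  have := EX_mul_left pot p c (fun _ => 1)
  rw [EX_one] at this
  simpa using this

theorem EX_split {pot : Finset E} (p : ℝ) {e : E} (he : e ∈ pot) (f : Finset E → ℝ) :
    EX pot p f = EX (pot.erase e) p (fun G => (1 - p) * f G + p * f (insert e G)) := by
  have h0 : pot = insert e (pot.erase e) := (insert_erase he).symm
  have hc : pot.card = (pot.erase e).card + 1 := (card_erase_add_one he).symm
  have hne : e ∉ pot.erase e := notMem_erase e pot
  unfold EX
  conv_lhs => rw [h0]
  rw [sum_powerset_insert hne, ← sum_add_distrib]
  refine sum_congr rfl fun G hG => ?_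
  have hG' := mem_powerset.1 hG
  have heG : e ∉ G := fun h => hne (hG' h)
  have hle := card_le_card hG'
  rw [card_insert_of_notMem heG, card_insert_of_notMem hne]
  have e1 : (pot.erase e).card + 1 - G.card = ((pot.erase e).card - G.card) + 1 := by omega
  have e2 : (pot.erase e).card + 1 - (G.card + 1) = (pot.erase e).card - G.card := by omega
  rw [e1, e2, pow_succ, pow_succ]
  ring

theorem EX_congr {pot : Finset E} {p : ℝ} {f g : Finset E → ℝ}
    (h : ∀ G, G ⊆ pot → f G = g G) : EX pot p f = EX pot p g :=
  sum_congr rfl fun G hG => by rw [h G (mem_powerset.1 hG)]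

theorem EX_chi {pot : Finset E} {p : ℝ} (hp : p ≠ 0) {e : E} (he : e ∈ pot) (Φ : Finset E → ℝ)
    (hΦ : ∀ G, Φ (insert e G) = Φ G) : EX pot p (fun G => Φ G * ch p G e) = 0 := by
  rw [EX_split p he]
  rw [EX_congr (g := fun _ => 0), EX_const]
  intro G hG
  have heG : e ∉ G := fun h => notMem_erase e pot (hG h)
  simp only [ch, heG, mem_insert_self, if_true, if_false, hΦ]
  field_simp
  ring

theorem EX_ind {pot : Finset E} {p : ℝ} {e : E} (he : e ∈ pot) (Φ : Finset E → ℝ)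
    (hΦ : ∀ G, Φ (insert e G) = Φ G) :
    EX pot p (fun G => Φ G * (if e ∈ G then 1 else 0)) = p * EX pot p Φ := by
  rw [EX_split p he, EX_split p he Φ, ← EX_mul_left]
  refine EX_congr fun G hG => ?_
  have heG : e ∉ G := fun h => notMem_erase e pot (hG h)
  simp only [heG, mem_insert_self, if_true, if_false, hΦ]
  ring

theorem EX_prod_ind {pot : Finset E} {p : ℝ} (S : Finset E) (hS : S ⊆ pot) :
    EX pot p (fun G => ∏ e ∈ S, if e ∈ G then 1 else 0) = p ^ S.card := by
  induction S using Finset.induction_on with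
  | empty => simp [EX_one]
  | insert e S he ih =>
    rw [card_insert_of_notMem he, pow_succ, mul_comm, ← ih (fun x hx => hS (mem_insert_of_mem hx)),
      ← EX_ind (hS (mem_insert_self e S))]
    · congr 1; funext G; rw [prod_insert he, mul_comm]
    · intro G
      refine prod_congr rfl fun x hx => ?_
      have : x ≠ e := fun h => he (h ▸ hx)
      simp [mem_insert, this]

open Classical in
/-- Probability of an event. -/
noncomputable def PR (pot : Finset E) (p : ℝ) (P : Finset E → Prop) : ℝ :=
  EX pot p (fun G => if P G then 1 else 0)

theorem PR_union {ι : Type*} {s : Finset ι} {pot : Finset E} {p : ℝ} (hp : 0 ≤ p) (hp1 : p ≤ 1)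
    (P : Finset E → Prop) (Q : ι → Finset E → Prop) (b : ι → ℝ) (h : ∀ G, P G → ∃ i ∈ s, Q i G)
    (hb : ∀ i ∈ s, PR pot p (Q i) ≤ b i) : PR pot p P ≤ ∑ i ∈ s, b i := by
  classical
  calc PR pot p P ≤ EX pot p (fun G => ∑ i ∈ s, if Q i G then 1 else 0) := by
        refine EX_mono hp hp1 fun G => ?_
        split_ifs with hG
        · obtain ⟨i, hi, hq⟩ := h G hG
          have := single_le_sum (f := fun i => if Q i G then (1:ℝ) else 0)
            (fun i _ => by split_ifs <;> norm_num) hi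
          simpa [hq] using this
        · exact sum_nonneg fun i _ => by split_ifs <;> norm_num
    _ = ∑ i ∈ s, PR pot p (Q i) := by rw [EX_sum]; rfl
    _ ≤ _ := sum_le_sum hb

theorem PR_or {pot : Finset E} {p : ℝ} (hp : 0 ≤ p) (hp1 : p ≤ 1)
    (P Q R : Finset E → Prop) (h : ∀ G, P G → Q G ∨ R G) :
    PR pot p P ≤ PR pot p Q + PR pot p R := by
  classical
  unfold PR
  rw [← EX_add]
  refine EX_mono hp hp1 fun G => ?_
  have := h G
  split_ifs <;> simp_all

/-- Markov inequality. -/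
theorem PR_markov {pot : Finset E} {p : ℝ} (hp : 0 ≤ p) (hp1 : p ≤ 1)
    (P : Finset E → Prop) (f : Finset E → ℝ) (hf : ∀ G, 0 ≤ f G) (a : ℝ) (ha : 0 < a)
    (h : ∀ G, P G → a ≤ f G) : PR pot p P ≤ EX pot p f / a := by
  classical
  rw [le_div_iff₀ ha, mul_comm]
  unfold PR
  rw [← EX_mul_left]
  refine EX_mono hp hp1 fun G => ?_
  split_ifs with hG
  · simpa using h G hG
  · simpa using hf G

end EXsec

theorem probG_eq {k n : ℕ} {p : ℝ} (P : Finset (Sym2 (Vtx k n)) → Prop) :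
    probG k n p P = PR (potEdges k n) p P := by
  unfold probG PR EX
  refine sum_congr rfl fun G _ => ?_
  split_ifs <;> simp_all

theorem probG_ge {k n : ℕ} {p : ℝ} (hp : 0 ≤ p) (hp1 : p ≤ 1)
    (P Q : Finset (Sym2 (Vtx k n)) → Prop) (h : ∀ G, ¬ Q G → P G) :
    1 - PR (potEdges k n) p Q ≤ probG k n p P := by
  classical
  rw [probG_eq]
  have : (1:ℝ) = PR (potEdges k n) p (fun _ => True) := by
    unfold PR; simp [EX_one]
  have h2 := PR_or (pot := potEdges k n) hp hp1 (fun _ => True) P Q (fun G _ => by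
    by_cases hq : Q G
    · exact Or.inr hq
    · exact Or.inl (h G hq))
  linarith

theorem pow_self_le (m : ℕ) : m ^ m ≤ m.factorial * 3 ^ m := by
  have h := Real.pow_div_factorial_le_exp (m : ℝ) (by positivity) m
  have h3 : Real.exp (m : ℝ) ≤ 3 ^ m := by
    have : Real.exp (m : ℝ) = Real.exp 1 ^ m := by rw [← Real.exp_nat_mul]; simp
    rw [this]
    exact pow_le_pow_left₀ (Real.exp_pos 1).le (by have := Real.exp_one_lt_d9; linarith) m
  rw [div_le_iff₀ (by positivity)] at h
  have : (m : ℝ) ^ m ≤ m.factorial * 3 ^ m := by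
    calc (m : ℝ) ^ m ≤ _ := h
      _ ≤ 3 ^ m * m.factorial := by gcongr
      _ = _ := by ring
  exact_mod_cast this

theorem count_le {β : Type*} [Fintype β] [DecidableEq β] (m : ℕ) (hm : m ≤ Fintype.card β) :
    (univ.filter fun f : Fin (2 * m) → β => ∀ r, ∃ r', r' ≠ r ∧ f r' = f r).card ≤
      Fintype.card β ^ m * (3 * m) ^ m := by
  have hsub : (univ.filter fun f : Fin (2 * m) → β => ∀ r, ∃ r', r' ≠ r ∧ f r' = f r) ⊆
      (powersetCard m (univ : Finset β)).biUnion fun T => Fintype.piFinset fun _ => T := by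
    intro f hf
    have hf := (mem_filter.1 hf).2
    have h1 : 2 * (univ.image f).card ≤ (univ : Finset (Fin (2 * m))).card := by
      refine mul_card_image_le_card _ _ fun a ha => ?_
      obtain ⟨r, _, hr⟩ := mem_image.1 ha
      obtain ⟨r', hne, hr'⟩ := hf r
      have : ({r', r} : Finset _) ⊆ univ.filter fun x => f x = a := by
        intro x hx
        simp only [mem_insert, mem_singleton] at hx
        rcases hx with rfl | rfl <;> simp [hr, hr']
      calc 2 = ({r', r} : Finset (Fin (2 * m))).card := (card_pair hne).symm
        _ ≤ _ := card_le_card this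
    rw [card_univ, Fintype.card_fin] at h1
    obtain ⟨T, hT1, hT2⟩ := exists_superset_card_eq (s := univ.image f) (n := m) (by omega) hm
    simp only [mem_biUnion, mem_powersetCard]
    exact ⟨T, ⟨subset_univ _, hT2⟩,
      Fintype.mem_piFinset.2 fun r => hT1 (mem_image_of_mem f (mem_univ r))⟩
  have h2 := (card_le_card hsub).trans (card_biUnion_le)
  have h3 : ∑ T ∈ powersetCard m (univ : Finset β),
      (Fintype.piFinset fun _ : Fin (2 * m) => T).card = (Fintype.card β).choose m * m ^ (2 * m) := by
    rw [sum_congr rfl (g := fun _ => m ^ (2 * m))]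
    · simp [card_powersetCard]
    · intro T hT
      rw [Fintype.card_piFinset]
      simp [(mem_powersetCard.1 hT).2]
  rw [h3] at h2
  refine h2.trans ?_
  have h4 : (Fintype.card β).choose m * m.factorial ≤ Fintype.card β ^ m := by
    rw [mul_comm, ← Nat.descFactorial_eq_factorial_mul_choose]
    exact Nat.descFactorial_le_pow _ _
  calc (Fintype.card β).choose m * m ^ (2 * m)
      = (Fintype.card β).choose m * m ^ m * m ^ m := by rw [two_mul, pow_add]; ring
    _ ≤ (Fintype.card β).choose m * (m.factorial * 3 ^ m) * m ^ m := by
        gcongr; exact pow_self_le m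
    _ = ((Fintype.card β).choose m * m.factorial) * (3 * m) ^ m := by rw [mul_pow]; ring
    _ ≤ _ := by gcongr

section chaos
variable {E : Type*} [DecidableEq E] {ι β : Type*} [Fintype ι] [DecidableEq ι] [Fintype β]
  [DecidableEq β]

theorem abs_ch_le {p : ℝ} (hp : 0 < p) (hp1 : p ≤ 1) (G : Finset E) (e : E) :
    |ch p G e| ≤ 1 / p := by
  unfold ch
  split_ifs
  · rw [abs_div, abs_of_pos hp, abs_of_nonneg (by linarith)]
    gcongr; linarith
  · rw [abs_neg, abs_one, le_div_iff₀ hp]; linarith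

theorem ch_insert {p : ℝ} {G : Finset E} {e f : E} (h : f ≠ e) :
    ch p (insert e G) f = ch p G f := by
  simp [ch, h]

theorem chaos {pot : Finset E} {p : ℝ} (hp : 0 < p) (hp1 : p ≤ 1) (e : ι → β → E)
    (he : ∀ l b l' b', e l b = e l' b' → l = l' ∧ b = b') (hpot : ∀ l b, e l b ∈ pot)
    (Ψ : Finset E → (ι → β) → ℝ) (hΨ : ∀ G l b z, Ψ (insert (e l b) G) z = Ψ G z)
    (b0 lam : ℝ) (hb0 : 0 ≤ b0) (hlam : 0 < lam) (m : ℕ) (hm : m ≤ Fintype.card β) :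
    PR pot p (fun G => (∀ z, |Ψ G z| ≤ b0) ∧ lam < |∑ z, Ψ G z * ∏ l, ch p G (e l (z l))|) ≤
      (b0 ^ 2 * ((1 / p) ^ 2 * (Fintype.card β * (3 * m))) ^ Fintype.card ι / lam ^ 2) ^ m := by
  classical
  set Y : Finset E → ℝ := fun G => if ∀ z, |Ψ G z| ≤ b0 then 1 else 0 with hY
  set tr : (Fin (2 * m) → ι → β) → Finset E → ℝ := fun q G =>
    Y G * ∏ r, (Ψ G (q r) * ∏ l, ch p G (e l (q r l))) with htr
  have hstep1 : PR pot p (fun G => (∀ z, |Ψ G z| ≤ b0) ∧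
      lam < |∑ z, Ψ G z * ∏ l, ch p G (e l (z l))|) ≤
      EX pot p (fun G => ∑ q, tr q G) / lam ^ (2 * m) := by
    have hexp : ∀ G, ∑ q, tr q G = Y G * (∑ z, Ψ G z * ∏ l, ch p G (e l (z l))) ^ (2 * m) := by
      intro G
      rw [Fintype.sum_pow, mul_sum]
    refine PR_markov hp.le hp1 _ _ (fun G => ?_) _ (by positivity) (fun G hG => ?_)
    · rw [hexp]
      refine mul_nonneg ?_ ?_
      · simp only [hY]; split_ifs <;> norm_num
      · rw [pow_mul]; positivity
    · rw [hexp]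
      have : Y G = 1 := by simp only [hY]; rw [if_pos hG.1]
      rw [this, one_mul, pow_mul, pow_mul, ← sq_abs (∑ z, _)]
      have := hG.2.le
      gcongr
  set good : Finset (Fin (2 * m) → ι → β) :=
    univ.filter fun q => ∀ l r, ∃ r', r' ≠ r ∧ q r' l = q r l with hgood
  have hbad : ∀ q, q ∉ good → EX pot p (tr q) = 0 := by
    intro q hq
    simp only [hgood, mem_filter, mem_univ, true_and] at hq
    push Not at hq
    obtain ⟨l, r, hlr⟩ := hq
    have hrest := EX_chi (pot := pot) (p := p) hp.ne' (hpot l (q r l)) (fun G =>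
      Y G * ((∏ r, Ψ G (q r)) *
        ∏ x ∈ (univ : Finset (Fin (2 * m) × ι)).erase (r, l), ch p G (e x.2 (q x.1 x.2)))) ?_
    · rw [← hrest]
      congr 1
      funext G
      simp only [htr]
      rw [prod_mul_distrib]
      have : ∏ r, ∏ l, ch p G (e l (q r l)) =
          ∏ x : Fin (2 * m) × ι, ch p G (e x.2 (q x.1 x.2)) := by
        rw [Fintype.prod_prod_type]
      rw [this, ← prod_erase_mul _ _ (mem_univ ((r, l) : Fin (2 * m) × ι))]
      ring
    · intro G
      simp only [hY, hΨ]
      congr 2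
      refine prod_congr rfl fun x hx => ?_
      refine ch_insert fun h => ?_
      obtain ⟨h1, h2⟩ := he _ _ _ _ h
      obtain ⟨r', l'⟩ := x
      simp only at h1 h2
      subst h1
      by_cases hr : r' = r
      · subst hr; simp at hx
      · exact hlr r' hr h2
  have hgd : ∀ q, EX pot p (tr q) ≤ (b0 * (1 / p) ^ Fintype.card ι) ^ (2 * m) := by
    intro q
    rw [← EX_const pot p ((b0 * (1 / p) ^ Fintype.card ι) ^ (2 * m))]
    refine EX_mono hp.le hp1 fun G => ?_
    refine (le_abs_self _).trans ?_
    simp only [htr, hY]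
    split_ifs with hA
    · rw [one_mul, abs_prod]
      calc ∏ r, |Ψ G (q r) * ∏ l, ch p G (e l (q r l))|
          ≤ ∏ r : Fin (2 * m), (b0 * (1 / p) ^ Fintype.card ι) := by
            refine prod_le_prod (fun _ _ => abs_nonneg _) fun r _ => ?_
            rw [abs_mul, abs_prod]
            refine mul_le_mul (hA _) ?_ (prod_nonneg fun _ _ => abs_nonneg _) hb0
            calc ∏ l, |ch p G (e l (q r l))| ≤ ∏ l : ι, (1 / p) :=
                  prod_le_prod (fun _ _ => abs_nonneg _) fun l _ => abs_ch_le hp hp1 _ _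
              _ = _ := by rw [prod_const, card_univ]
        _ = _ := by rw [prod_const, card_univ, Fintype.card_fin]
    · rw [zero_mul, abs_zero]; positivity
  have hcount : (good.card : ℝ) ≤ (((Fintype.card β : ℝ) * (3 * m)) ^ m) ^ Fintype.card ι := by
    have h1 : good.card ≤ (Fintype.piFinset fun _ : ι =>
        (univ.filter fun f : Fin (2 * m) → β => ∀ r, ∃ r', r' ≠ r ∧ f r' = f r)).card := by
      refine card_le_card_of_injOn (fun q l r => q r l) (fun q hq => ?_) ?_
      · have hq := (mem_filter.1 hq).2
        simp only [mem_coe, mem_filter, mem_univ, true_and, Fintype.mem_piFinset]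
        simpa using hq
      · intro q _ q' _ h
        funext r l
        exact congrFun (congrFun h l) r
    rw [Fintype.card_piFinset, prod_const, card_univ] at h1
    have h2 := h1.trans (Nat.pow_le_pow_left (count_le m hm) _)
    rw [← mul_pow] at h2
    exact_mod_cast h2
  have hEX : EX pot p (fun G => ∑ q, tr q G) ≤
      good.card * (b0 * (1 / p) ^ Fintype.card ι) ^ (2 * m) := by
    rw [EX_sum]
    calc ∑ q, EX pot p (tr q) = ∑ q ∈ good, EX pot p (tr q) := by
          symm
          exact sum_subset (subset_univ _) fun q _ hq => hbad q hq
      _ ≤ ∑ q ∈ good, (b0 * (1 / p) ^ Fintype.card ι) ^ (2 * m) := sum_le_sum fun q _ => hgd q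
      _ = _ := by rw [sum_const, nsmul_eq_mul]
  refine hstep1.trans ?_
  rw [div_pow, ← pow_mul lam]
  gcongr
  refine hEX.trans ?_
  calc (good.card : ℝ) * (b0 * (1 / p) ^ Fintype.card ι) ^ (2 * m)
      ≤ (((Fintype.card β : ℝ) * (3 * m)) ^ m) ^ Fintype.card ι *
        (b0 * (1 / p) ^ Fintype.card ι) ^ (2 * m) := by gcongr
    _ = _ := by
        rw [pow_right_comm, pow_mul, ← mul_pow]
        congr 1
        simp only [mul_pow, ← pow_mul]
        ring
end chaos

section codeg
variable {k n : ℕ}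

theorem mem_pot {a b : Fin k} {x y : Fin n} (h : a ≠ b) : s((a, x), (b, y)) ∈ potEdges k n := by
  simp [potEdges, h]

/-- Common neighbours in block `j` of the vertices of `t` in the blocks `B`. -/
def nb (G : Finset (Sym2 (Vtx k n))) (j : Fin k) (B : Finset (Fin k)) (t : Tup k n) :
    Finset (Fin n) := univ.filter fun y : Fin n => ∀ a ∈ B, s((a, t a), (j, y)) ∈ G

theorem EX_codeg (p c : ℝ) (j : Fin k) (B : Finset (Fin k)) (t : Tup k n)
    (hj : j ∉ B) : EX (potEdges k n) p (fun G => (1 + c) ^ (nb G j B t).card) =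
      (1 + c * p ^ B.card) ^ n := by
  have h1 : ∀ G : Finset (Sym2 (Vtx k n)), (1 + c) ^ (nb G j B t).card =
      ∑ Y : Finset (Fin n), c ^ Y.card *
        ∏ e ∈ (Y ×ˢ B).image (fun ya => (s((ya.2, t ya.2), (j, ya.1)) : Sym2 (Vtx k n))),
          if e ∈ G then 1 else 0 := by
    intro G
    have h2 : (1 + c) ^ (nb G j B t).card =
        ∏ y : Fin n, (1 + c * if ∀ a ∈ B, s((a, t a), (j, y)) ∈ G then 1 else 0) := by
      rw [nb, ← prod_const, prod_filter]
      refine prod_congr rfl fun y _ => ?_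
      split_ifs <;> simp
    rw [h2, prod_one_add, ← powerset_univ]
    refine sum_congr rfl fun Y _ => ?_
    rw [prod_mul_distrib, prod_const, prod_image, prod_product]
    · congr 1
      refine prod_congr rfl fun y _ => ?_
      rw [prod_ite_zero]
      simp
    · rintro ⟨y, a⟩ h ⟨y', a'⟩ h' hE
      simp only [coe_product, Set.mem_prod, mem_coe] at h h'
      simp only [Sym2.eq_iff, Prod.mk.injEq] at hE
      rcases hE with hE | hE
      · simp [hE.1.1, hE.2.2]
      · exact absurd h.2 (hE.1.1 ▸ hj)
  simp only [h1]
  rw [EX_sum]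
  have h3 : (1 + c * p ^ B.card) ^ n = ∏ y : Fin n, (1 + c * p ^ B.card) := by simp
  rw [h3, prod_one_add, ← powerset_univ]
  refine sum_congr rfl fun Y _ => ?_
  rw [EX_mul_left, EX_prod_ind]
  · rw [card_image_of_injOn, card_product, prod_mul_distrib, prod_const, prod_const, ← pow_mul,
      mul_comm Y.card]
    rintro ⟨y, a⟩ h ⟨y', a'⟩ h' hE
    simp only [coe_product, Set.mem_prod, mem_coe] at h h'
    simp only [Sym2.eq_iff, Prod.mk.injEq] at hE
    rcases hE with hE | hE
    · simp [hE.1.1, hE.2.2]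
    · exact absurd h.2 (hE.1.1 ▸ hj)
  · intro e he
    obtain ⟨⟨y, a⟩, hya, rfl⟩ := mem_image.1 he
    refine mem_pot fun h => hj ?_
    simp only [mem_product] at hya h
    exact h ▸ hya.2

theorem codeg_fail {p : ℝ} (hp : 0 < p) (hp1 : p ≤ 1) (j : Fin k) (B : Finset (Fin k))
    (t : Tup k n) (hj : j ∉ B) (ε : ℝ) (hε : 0 < ε) (hε1 : ε ≤ 1) :
    PR (potEdges k n) p (fun G => (1 + ε) * (p ^ B.card * n) < (nb G j B t).card) ≤
      Real.exp (-(ε ^ 2 * (p ^ B.card * n) / 4)) := by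
  set P := p ^ B.card * n with hP
  have hP0 : 0 ≤ P := by positivity
  set c := ε / 2 with hc
  have hc0 : 0 < c := by positivity
  have hlog : c - c ^ 2 / 2 ≤ Real.log (1 + c) := by
    refine le_trans ?_ (Real.le_log_one_add_of_nonneg hc0.le)
    rw [le_div_iff₀ (by linarith)]
    nlinarith [pow_pos hc0 3]
  have hcc : 0 ≤ c - c ^ 2 / 2 := by nlinarith
  have h := PR_markov (pot := potEdges k n) hp.le hp1
    (fun G => (1 + ε) * P < (nb G j B t).card) (fun G => (1 + c) ^ (nb G j B t).card)
    (fun G => by positivity) (Real.exp ((c - c ^ 2 / 2) * ((1 + ε) * P))) (Real.exp_pos _) (by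
      intro G hG
      rw [← Real.exp_log (show (0:ℝ) < 1 + c by linarith), ← Real.exp_nat_mul, Real.exp_le_exp,
        mul_comm (_ : ℝ) (Real.log _)]
      exact mul_le_mul hlog hG.le (by positivity) (hcc.trans hlog))
  refine h.trans ?_
  rw [EX_codeg p c j B t hj]
  have h2 : (1 + c * p ^ B.card) ^ n ≤ Real.exp (c * P) := by
    have : c * P = n * (c * p ^ B.card) := by rw [hP]; ring
    rw [this, Real.exp_nat_mul]
    refine pow_le_pow_left₀ (by positivity) ?_ n
    rw [add_comm]; exact Real.add_one_le_exp _
  rw [div_le_iff₀ (Real.exp_pos _), ← Real.exp_add]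
  refine h2.trans (Real.exp_le_exp.2 ?_)
  have : 0 ≤ (ε ^ 2 / 8) * (1 - ε) * P := by
    have : 0 ≤ 1 - ε := by linarith
    positivity
  rw [hc]
  nlinarith

/-- The codegree event. -/
def Cod (p : ℝ) (b : ℕ) (G : Finset (Sym2 (Vtx k n))) : Prop :=
  ∀ (j : Fin k) (B : Finset (Fin k)) (t : Tup k n), j ∉ B → B.card ≤ b →
    ((nb G j B t).card : ℝ) ≤ (1 + 1 / k) * (p ^ B.card * n)

theorem cod_fail {p : ℝ} (hp : 0 < p) (hp1 : p ≤ 1) (b : ℕ) (hk : 1 ≤ k) :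
    PR (potEdges k n) p (fun G => ¬ Cod p b G) ≤
      k * 2 ^ k * n ^ k * Real.exp (-(p ^ b * n / (4 * k ^ 2))) := by
  classical
  have hk' : (1 : ℝ) ≤ k := by exact_mod_cast hk
  have h := PR_union (pot := potEdges k n)
    (s := (univ : Finset (Fin k × Finset (Fin k) × Tup k n))) hp.le hp1
    (fun G => ¬ Cod p b G) (fun i G => i.1 ∉ i.2.1 ∧ i.2.1.card ≤ b ∧
      (1 + 1 / k) * (p ^ i.2.1.card * n) < (nb G i.1 i.2.1 i.2.2).card)
    (fun _ => Real.exp (-(p ^ b * n / (4 * k ^ 2)))) (by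
      intro G hG
      unfold Cod at hG
      push Not at hG
      obtain ⟨j, B, t, h1, h2, h3⟩ := hG
      exact ⟨(j, B, t), mem_univ _, h1, h2, h3⟩) (by
      rintro ⟨j, B, t⟩ -
      simp only
      by_cases hjB : j ∉ B ∧ B.card ≤ b
      · refine le_trans (EX_mono hp.le hp1 (g := fun G =>
          if (1 + (1 / k : ℝ)) * (p ^ B.card * n) < (nb G j B t).card then 1 else 0) ?_) ?_
        · intro G
          simp [hjB.1, hjB.2]
        · refine le_trans (codeg_fail hp hp1 j B t hjB.1 (1 / k) (by positivity)
            (by rw [div_le_one (by linarith)]; exact hk')) ?_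
          rw [Real.exp_le_exp, neg_le_neg_iff]
          have : p ^ b ≤ p ^ B.card := pow_le_pow_of_le_one hp.le hp1 hjB.2
          calc p ^ b * n / (4 * k ^ 2) ≤ p ^ B.card * n / (4 * k ^ 2) := by gcongr
            _ = _ := by field_simp
      · have : ∀ G : Finset (Sym2 (Vtx k n)), ¬ (j ∉ B ∧ B.card ≤ b ∧
            (1 + (1 / k : ℝ)) * (p ^ B.card * n) < (nb G j B t).card) :=
          fun G hh => hjB ⟨hh.1, hh.2.1⟩
        unfold PR
        simp only [this, if_false, EX_const]
        positivity)
  refine h.trans (le_of_eq ?_)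
  rw [sum_const, nsmul_eq_mul, card_univ]
  simp [Fintype.card_prod, mul_assoc]

end codeg

section KE
variable {k n : ℕ}

/-- The characters of the edges of a tuple. -/
noncomputable def XX (p : ℝ) (G : Finset (Sym2 (Vtx k n))) (t : Tup k n) (e : Fin k × Fin k) : ℝ :=
  ch p G s((e.1, t e.1), (e.2, t e.2))

/-- A factor of a product term. -/
noncomputable def fac (τ : Fin k × Fin k → Fin 3) (X : Fin k × Fin k → ℝ) (e : Fin k × Fin k) : ℝ :=
  if τ e = 1 then X e else if τ e = 2 then 1 + X e else 1

/-- Combine two tuples. -/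
def mix (W : Finset (Fin k)) (t t' : Tup k n) : Tup k n := fun i => if i ∈ W then t i else t' i

theorem sum_mix (W : Finset (Fin k)) (F : Tup k n → ℝ) :
    ∑ t, ∑ t', F (mix W t t') = (n : ℝ) ^ k * ∑ t, F t := by
  have hinv : Function.Involutive (fun x : Tup k n × Tup k n => (mix W x.1 x.2, mix W x.2 x.1)) := by
    rintro ⟨a, b⟩
    simp only [Prod.mk.injEq]
    constructor <;> funext i <;> simp only [mix] <;> split_ifs <;> rfl
  have h := Equiv.sum_comp hinv.toPerm (fun x : Tup k n × Tup k n => F x.1)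
  rw [Fintype.sum_prod_type, Fintype.sum_prod_type] at h
  simp only [Function.Involutive.coe_toPerm] at h
  rw [h, mul_sum]
  refine sum_congr rfl fun t _ => ?_
  simp

/-- The values of a tuple on the pairs of `N`. -/
def vt (N : Finset (Fin k × Fin k)) (t : Tup k n) : N → Fin n × Fin n :=
  fun l => (t l.1.1, t l.1.2)

theorem card_vv (N : Finset (Fin k × Fin k)) (h : Mat N) (hlt : ∀ e ∈ N, e.1 < e.2) :
    (vv N).card = 2 * N.card := by
  unfold vv
  rw [card_biUnion (fun e he e' he' hne => h e he e' he' hne), sum_congr rfl (g := fun _ => 2)]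
  · simp [mul_comm]
  · intro e he
    exact card_pair (hlt e he).ne

theorem card_fib (N : Finset (Fin k × Fin k)) (h : Mat N) (hlt : ∀ e ∈ N, e.1 < e.2)
    (z : N → Fin n × Fin n) :
    (univ.filter fun t : Tup k n => vt N t = z).card * n ^ (2 * N.card) ≤ n ^ k := by
  have h1 : ((univ.filter fun t : Tup k n => vt N t = z) ×ˢ
      (univ : Finset (vv N → Fin n))).card ≤ (univ : Finset (Tup k n)).card := by
    refine card_le_card_of_injOn (fun x i => if hi : i ∈ vv N then x.2 ⟨i, hi⟩ else x.1 i)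
      (fun _ _ => mem_coe.2 (mem_univ _)) ?_
    rintro ⟨t, r⟩ ht ⟨t', r'⟩ ht' hE
    simp only [coe_product, coe_filter, mem_univ, true_and, coe_univ, Set.mem_prod, Set.mem_ofPred_eq,
      Set.mem_univ, and_true] at ht ht'
    simp only [Prod.mk.injEq]
    constructor
    · funext i
      by_cases hi : i ∈ vv N
      · have hi' := hi
        unfold vv at hi'
        obtain ⟨e, he, hie⟩ := mem_biUnion.1 hi'
        have h2 := congrFun (ht.trans ht'.symm) ⟨e, he⟩
        simp only [vt, Prod.mk.injEq] at h2
        simp only [mem_insert, mem_singleton] at hie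
        rcases hie with rfl | rfl
        · exact h2.1
        · exact h2.2
      · have := congrFun hE i
        simpa [hi] using this
    · funext ⟨i, hi⟩
      have := congrFun hE i
      simpa [hi] using this
  rw [card_product] at h1
  simpa [card_vv N h hlt] using h1

theorem one_add_ch {p : ℝ} (hp : p ≠ 0) (G : Finset (Sym2 (Vtx k n))) (e : Sym2 (Vtx k n)) :
    1 + ch p G e = 1 / p * if e ∈ G then 1 else 0 := by
  unfold ch
  split_ifs
  · field_simp; ring
  · simp

/-- Neighbouring blocks. -/
def BB (τ : Fin k × Fin k → Fin 3) (W : Finset (Fin k)) (j : Fin k) : Finset (Fin k) :=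
  W.filter fun a => τ (a, j) = 2 ∨ τ (j, a) = 2

/-- The outer factor. -/
noncomputable def HH (p : ℝ) (G : Finset (Sym2 (Vtx k n))) (τ : Fin k × Fin k → Fin 3)
    (W : Finset (Fin k)) (t : Tup k n) (j : Fin k) (y : Fin n) : ℝ :=
  if j ∈ W then 1 else (1 / p) ^ (BB τ W j).card * if y ∈ nb G j (BB τ W j) t then 1 else 0

theorem fac_prod_le {p : ℝ} (hp : 0 < p) (hp1 : p ≤ 1) (G : Finset (Sym2 (Vtx k n)))
    {τ : Fin k × Fin k → Fin 3} {W : Finset (Fin k)} {N : Finset (Fin k × Fin k)}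
    (hA : Adm τ W N) (t : Tup k n) :
    ∏ e ∈ univ \ N, |fac τ (XX p G t) e| ≤
      (1 / p) ^ (W.card ^ 2) * ∏ j, HH p G τ W t j (t j) := by
  have h1p : 1 ≤ 1 / p := by rw [le_div_iff₀ hp]; linarith
  set u : Fin k × Fin k → ℝ := fun e => |fac τ (XX p G t) e| with hu
  have hu0 : ∀ e, 0 ≤ u e := fun e => abs_nonneg _
  have hup : ∀ e, u e ≤ 1 / p := by
    intro e
    simp only [hu, fac]
    split_ifs
    · exact abs_ch_le hp hp1 _ _
    · rw [XX, one_add_ch hp.ne']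
      split_ifs
      · rw [mul_one, abs_of_nonneg (by positivity)]
      · simp; positivity
    · simpa using h1p
  have hu0' : ∀ e, τ e = 0 → u e = 1 := by
    intro e he
    simp [hu, fac, he]
  have hu2 : ∀ e, τ e = 2 → u e = 1 / p * if s((e.1, t e.1), (e.2, t e.2)) ∈ G then 1 else 0 := by
    intro e he
    simp only [hu, fac, he]
    rw [if_neg (by decide), if_pos trivial, XX, one_add_ch hp.ne', abs_of_nonneg]
    split_ifs <;> positivity
  set A : Fin k × Fin k → ℝ := fun e => if e ∈ W ×ˢ W then 1 / p else 1 with hAdef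
  set Bf : Fin k × Fin k → ℝ := fun e => if e.1 ∈ W ∧ e.2 ∉ W then u e else 1 with hBf
  set Cf : Fin k × Fin k → ℝ := fun e => if e.1 ∉ W ∧ e.2 ∈ W then u e else 1 with hCf
  have hA1 : ∀ e, 1 ≤ A e := by intro e; simp only [hAdef]; split_ifs <;> linarith
  have hstep : ∏ e ∈ univ \ N, u e ≤ ∏ e, (A e * Bf e * Cf e) := by
    have hN : ∀ e ∈ N, A e * Bf e * Cf e = 1 / p := by
      intro e he
      have := hA.ins e (hA.one e he)
      simp [hAdef, hBf, hCf, this.1, this.2]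
    have h3 : ∀ e, u e ≤ A e * Bf e * Cf e := by
      intro e
      by_cases h1 : e.1 ∈ W <;> by_cases h2 : e.2 ∈ W
      · simpa [hAdef, hBf, hCf, h1, h2] using hup e
      · simp [hAdef, hBf, hCf, h1, h2]
      · simp [hAdef, hBf, hCf, h1, h2]
      · have : τ e = 0 := by
          have a1 : τ e ≠ 1 := fun h => h1 (hA.ins e h).1
          have a2 : τ e ≠ 2 := fun h => by
            rcases hA.tch e h with h | h
            · exact h1 h
            · exact h2 h
          generalize τ e = x at a1 a2 ⊢
          fin_cases x <;> simp_all
        simp [hAdef, hBf, hCf, h1, h2, hu0' e this]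
    calc ∏ e ∈ univ \ N, u e ≤ ∏ e ∈ univ \ N, (A e * Bf e * Cf e) :=
          prod_le_prod (fun e _ => hu0 e) fun e _ => h3 e
      _ = (∏ e ∈ univ \ N, (A e * Bf e * Cf e)) * 1 := (mul_one _).symm
      _ ≤ (∏ e ∈ univ \ N, (A e * Bf e * Cf e)) * ∏ e ∈ N, (A e * Bf e * Cf e) := by
          refine mul_le_mul_of_nonneg_left ?_ (prod_nonneg fun e _ => (hu0 e).trans (h3 e))
          rw [prod_congr rfl hN, prod_const]
          exact one_le_pow₀ h1p
      _ = _ := prod_sdiff (subset_univ N)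
  refine hstep.trans (le_of_eq ?_)
  rw [prod_mul_distrib, prod_mul_distrib, mul_assoc]
  congr 1
  · simp only [hAdef]
    rw [prod_ite, prod_const, prod_const_one, mul_one, filter_mem_eq_inter, univ_inter, card_product, sq]
  · rw [Fintype.prod_prod_type_right, Fintype.prod_prod_type, ← prod_mul_distrib]
    refine prod_congr rfl fun j _ => ?_
    rw [← prod_mul_distrib]
    by_cases hj : j ∈ W
    · simp [hBf, hCf, hj, HH]
    · have h4 : ∀ a, Bf (a, j) * Cf (j, a) =
          if a ∈ BB τ W j then 1 / p * (if s((a, t a), (j, t j)) ∈ G then 1 else 0) else 1 := by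
        intro a
        by_cases ha : a ∈ W
        · have n1 : τ (a, j) ≠ 1 := fun h => hj (hA.ins _ h).2
          have n2 : τ (j, a) ≠ 1 := fun h => hj (hA.ins _ h).1
          have z1 : τ (a, j) ≠ 2 → τ (a, j) = 0 := by
            intro h
            generalize τ (a, j) = x at n1 h ⊢
            fin_cases x <;> simp_all
          have z2 : τ (j, a) ≠ 2 → τ (j, a) = 0 := by
            intro h
            generalize τ (j, a) = x at n2 h ⊢
            fin_cases x <;> simp_all
          by_cases c1 : τ (a, j) = 2
          · have l1 : a < j := hA.lt (a, j) (by rw [c1]; decide)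
            have c2 : τ (j, a) = 0 := by
              by_contra h
              exact absurd (hA.lt (j, a) h) (not_lt.2 l1.le)
            simp only [hBf, hCf, ha, hj, not_false_eq_true, and_self, if_true, hu2 _ c1,
              hu0' _ c2, mul_one, BB, mem_filter, c1, true_or]
          · by_cases c2 : τ (j, a) = 2
            · simp only [hBf, hCf, ha, hj, not_false_eq_true, and_self, if_true, hu2 _ c2,
                hu0' _ (z1 c1), one_mul, BB, mem_filter, c2, or_true]
              rw [Sym2.eq_swap]
            · simp [hBf, hCf, ha, hj, hu0' _ (z1 c1), hu0' _ (z2 c2), BB, c1, c2]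
        · simp [hBf, hCf, ha, BB]
      simp only [h4]
      rw [prod_ite, prod_const_one, mul_one, filter_mem_eq_inter, univ_inter, prod_mul_distrib,
        prod_const, prod_ite_zero]
      simp [HH, hj, nb]

theorem one_add_inv_pow_le (k : ℕ) : (1 + 1 / (k : ℝ)) ^ k ≤ 3 := by
  rcases Nat.eq_zero_or_pos k with rfl | hk
  · simp
  · have hk' : (0 : ℝ) < k := by exact_mod_cast hk
    calc (1 + 1 / (k : ℝ)) ^ k ≤ Real.exp (1 / k) ^ k := by
          refine pow_le_pow_left₀ (by positivity) ?_ k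
          rw [add_comm]; exact Real.add_one_le_exp _
      _ = Real.exp 1 := by rw [← Real.exp_nat_mul]; congr 1; field_simp
      _ ≤ 3 := by have := Real.exp_one_lt_d9; linarith

theorem sum_HH_le {p : ℝ} (hp : 0 < p) {b : ℕ} {G : Finset (Sym2 (Vtx k n))} (hC : Cod p b G)
    {τ : Fin k × Fin k → Fin 3} {W : Finset (Fin k)} (hW : W.card ≤ b) (t : Tup k n) (j : Fin k) :
    ∑ y, HH p G τ W t j y ≤ (1 + 1 / k) * n := by
  unfold HH
  split_ifs with hj
  · simp only [sum_const, card_univ, Fintype.card_fin, nsmul_eq_mul, mul_one]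
    have : (0 : ℝ) ≤ 1 / k := by positivity
    nlinarith [(Nat.cast_nonneg n : (0:ℝ) ≤ n)]
  · rw [← mul_sum]
    have h1 := hC j (BB τ W j) t (fun h => hj (mem_filter.1 h).1)
      ((card_le_card (filter_subset _ _)).trans hW)
    rw [sum_boole, filter_mem_eq_inter, univ_inter]
    calc (1 / p) ^ (BB τ W j).card * ((nb G j (BB τ W j) t).card : ℝ)
        ≤ (1 / p) ^ (BB τ W j).card * ((1 + 1 / k) * (p ^ (BB τ W j).card * n)) := by gcongr
      _ = ((1 / p) * p) ^ (BB τ W j).card * ((1 + 1 / k) * n) := by rw [mul_pow]; ring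
      _ = _ := by rw [one_div_mul_cancel hp.ne', one_pow, one_mul]

theorem HH_nonneg {p : ℝ} (hp : 0 < p) (G : Finset (Sym2 (Vtx k n))) (τ : Fin k × Fin k → Fin 3)
    (W : Finset (Fin k)) (t : Tup k n) (j : Fin k) (y : Fin n) : 0 ≤ HH p G τ W t j y := by
  unfold HH
  split_ifs <;> positivity

theorem HH_mix (p : ℝ) (G : Finset (Sym2 (Vtx k n))) (τ : Fin k × Fin k → Fin 3)
    (W : Finset (Fin k)) (t t' : Tup k n) (j : Fin k) :
    HH p G τ W (mix W t t') j (mix W t t' j) = HH p G τ W t j (t' j) := by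
  by_cases hj : j ∈ W
  · simp [HH, hj]
  · have h1 : nb G j (BB τ W j) (mix W t t') = nb G j (BB τ W j) t := by
      unfold nb
      refine filter_congr fun y _ => forall₂_congr fun a ha => ?_
      have : mix W t t' a = t a := by simp [mix, (mem_filter.1 ha).1]
      rw [this]
    have h2 : mix W t t' j = t' j := by simp [mix, hj]
    simp only [HH, hj, if_false, h1, h2]

theorem fib_sum_le {p : ℝ} (hp : 0 < p) (hn : 1 ≤ n) {b : ℕ}
    {G : Finset (Sym2 (Vtx k n))} (hC : Cod p b G)
    {τ : Fin k × Fin k → Fin 3} {W : Finset (Fin k)} {N : Finset (Fin k × Fin k)}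
    (hA : Adm τ W N) (hW : W.card ≤ b) (z : N → Fin n × Fin n) :
    ∑ t ∈ univ.filter (fun t : Tup k n => vt N t = z), ∏ j, HH p G τ W t j (t j) ≤
      3 * (univ.filter fun t : Tup k n => vt N t = z).card := by
  have hn' : (0 : ℝ) < (n : ℝ) ^ k := by
    have : (0 : ℝ) < n := by exact_mod_cast hn
    positivity
  have hvmix : ∀ t t' : Tup k n, vt N (mix W t t') = vt N t := by
    intro t t'
    funext ⟨e, he⟩
    have := hA.ins e (hA.one e he)
    simp [vt, mix, this.1, this.2]
  have h := sum_mix W (fun t : Tup k n => if vt N t = z then ∏ j, HH p G τ W t j (t j) else 0)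
  rw [sum_filter]
  refine le_of_mul_le_mul_left ?_ hn'
  rw [← h]
  simp only [hvmix, HH_mix]
  calc ∑ t : Tup k n, ∑ t' : Tup k n, (if vt N t = z then ∏ j, HH p G τ W t j (t' j) else 0)
      ≤ ∑ t : Tup k n, (if vt N t = z then 3 * (n : ℝ) ^ k else 0) := by
        refine sum_le_sum fun t _ => ?_
        split_ifs with hz
        · rw [← Fintype.piFinset_univ, ← prod_univ_sum]
          calc ∏ j, ∑ y, HH p G τ W t j y ≤ ∏ j : Fin k, ((1 + 1 / (k : ℝ)) * n) :=
                prod_le_prod (fun j _ => sum_nonneg fun y _ => HH_nonneg hp _ _ _ _ _ _)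
                  fun j _ => sum_HH_le hp hC hW t j
            _ = (1 + 1 / (k : ℝ)) ^ k * (n : ℝ) ^ k := by
                rw [prod_const, card_univ, Fintype.card_fin, mul_pow]
            _ ≤ _ := by
                gcongr; exact one_add_inv_pow_le k
        · simp
    _ = _ := by
        rw [← sum_filter, sum_const, nsmul_eq_mul]; ring

end KE

section KE2
variable {k n : ℕ}

/-- The coefficient of the chaos. -/
noncomputable def Psi (p : ℝ) (g : Fin k → Fin n → ℝ) (τ : Fin k × Fin k → Fin 3)
    (N : Finset (Fin k × Fin k)) (G : Finset (Sym2 (Vtx k n))) (z : N → Fin n × Fin n) : ℝ :=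
  ∑ t ∈ univ.filter (fun t : Tup k n => vt N t = z), ((n : ℝ) ^ k)⁻¹ * (∏ i, g i (t i)) *
    ∏ e ∈ univ \ N, fac τ (XX p G t) e

theorem sum_eq_Psi (p : ℝ) (g : Fin k → Fin n → ℝ) (τ : Fin k × Fin k → Fin 3)
    (N : Finset (Fin k × Fin k)) (hone : ∀ e ∈ N, τ e = 1) (G : Finset (Sym2 (Vtx k n))) :
    ∑ t : Tup k n, ((n : ℝ) ^ k)⁻¹ * (∏ i, g i (t i)) * tm τ (XX p G t) =
      ∑ z, Psi p g τ N G z * ∏ l : N, ch p G s((l.1.1, (z l).1), (l.1.2, (z l).2)) := by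
  rw [← sum_fiberwise univ (vt N)]
  refine sum_congr rfl fun z _ => ?_
  rw [Psi, sum_mul]
  refine sum_congr rfl fun t ht => ?_
  have ht := (mem_filter.1 ht).2
  subst ht
  have h1 : tm τ (XX p G t) = ∏ e, fac τ (XX p G t) e := rfl
  rw [h1, ← prod_sdiff (subset_univ N), mul_assoc, mul_assoc, mul_assoc]
  congr 3
  rw [← prod_coe_sort]
  refine prod_congr rfl fun l _ => ?_
  simp [fac, hone l.1 l.2, XX, vt]

theorem Psi_insert (p : ℝ) (g : Fin k → Fin n → ℝ) {τ : Fin k × Fin k → Fin 3}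
    {W : Finset (Fin k)} {N : Finset (Fin k × Fin k)} (hA : Adm τ W N)
    (G : Finset (Sym2 (Vtx k n))) (l : N) (b : Fin n × Fin n) (z : N → Fin n × Fin n) :
    Psi p g τ N (insert s((l.1.1, b.1), (l.1.2, b.2)) G) z = Psi p g τ N G z := by
  unfold Psi
  refine sum_congr rfl fun t _ => ?_
  congr 1
  refine prod_congr rfl fun e he => ?_
  by_cases h0 : τ e = 0
  · simp [fac, h0]
  · have hlt := hA.lt e h0
    have hl1 := hA.one l.1 l.2
    have hllt := hA.lt l.1 (by rw [hl1]; decide)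
    have hne : e ≠ l.1 := fun h => (mem_sdiff.1 he).2 (h ▸ l.2)
    have hX : XX p (insert s((l.1.1, b.1), (l.1.2, b.2)) G) t e = XX p G t e := by
      unfold XX
      refine ch_insert fun h => ?_
      simp only [Sym2.eq_iff, Prod.mk.injEq] at h
      rcases h with h | h
      · exact hne (Prod.ext h.1.1 h.2.1)
      · rw [h.1.1, h.2.1] at hlt
        exact absurd hlt (not_lt.2 hllt.le)
    simp [fac, hX]

theorem Psi_le {p : ℝ} (hp : 0 < p) (hp1 : p ≤ 1) (hn : 1 ≤ n) (g : Fin k → Fin n → ℝ)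
    (hg : ∀ i x, |g i x| ≤ 1) {τ : Fin k × Fin k → Fin 3}
    {W : Finset (Fin k)} {N : Finset (Fin k × Fin k)} (hA : Adm τ W N) {b : ℕ} (hW : W.card ≤ b)
    {G : Finset (Sym2 (Vtx k n))} (hC : Cod p b G) (z : N → Fin n × Fin n) :
    |Psi p g τ N G z| ≤ 3 * (1 / p) ^ (W.card ^ 2) / (n : ℝ) ^ (2 * N.card) := by
  have hn0 : (0 : ℝ) < n := by exact_mod_cast hn
  have hcf : ((univ.filter fun t : Tup k n => vt N t = z).card : ℝ) * (n : ℝ) ^ (2 * N.card) ≤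
      (n : ℝ) ^ k := by
    exact_mod_cast card_fib N hA.mat (fun e he => hA.lt e (by rw [hA.one e he]; decide)) z
  calc |Psi p g τ N G z|
      ≤ ∑ t ∈ univ.filter (fun t : Tup k n => vt N t = z), ((n : ℝ) ^ k)⁻¹ *
          ((1 / p) ^ (W.card ^ 2) * ∏ j, HH p G τ W t j (t j)) := by
        refine (abs_sum_le_sum_abs _ _).trans (sum_le_sum fun t _ => ?_)
        rw [abs_mul, abs_mul, abs_of_nonneg (show (0 : ℝ) ≤ ((n : ℝ) ^ k)⁻¹ by positivity),
          abs_prod, abs_prod, mul_assoc]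
        refine mul_le_mul_of_nonneg_left ?_ (by positivity)
        have h1 : ∏ i, |g i (t i)| ≤ 1 := prod_le_one (fun _ _ => abs_nonneg _) fun i _ => hg _ _
        have h2 := fac_prod_le hp hp1 G hA t
        have h3 : 0 ≤ ∏ e ∈ univ \ N, |fac τ (XX p G t) e| := prod_nonneg fun _ _ => abs_nonneg _
        calc _ ≤ 1 * ∏ e ∈ univ \ N, |fac τ (XX p G t) e| := by gcongr
          _ ≤ _ := by rw [one_mul]; exact h2
    _ = ((n : ℝ) ^ k)⁻¹ * (1 / p) ^ (W.card ^ 2) *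
          ∑ t ∈ univ.filter (fun t : Tup k n => vt N t = z), ∏ j, HH p G τ W t j (t j) := by
        rw [mul_sum]; exact sum_congr rfl fun t _ => by ring
    _ ≤ ((n : ℝ) ^ k)⁻¹ * (1 / p) ^ (W.card ^ 2) *
          (3 * (univ.filter fun t : Tup k n => vt N t = z).card) := by
        gcongr
        exact fib_sum_le hp hn hC hA hW z
    _ ≤ _ := by
        rw [le_div_iff₀ (by positivity)]
        calc _ = ((n : ℝ) ^ k)⁻¹ * (1 / p) ^ (W.card ^ 2) * 3 *
              (((univ.filter fun t : Tup k n => vt N t = z).card : ℝ) * (n : ℝ) ^ (2 * N.card)) := by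
              ring
          _ ≤ ((n : ℝ) ^ k)⁻¹ * (1 / p) ^ (W.card ^ 2) * 3 * (n : ℝ) ^ k := by gcongr
          _ = _ := by field_simp

/-- Decay per matching edge. -/
noncomputable def rho (k n : ℕ) (p : ℝ) : ℝ := Real.sqrt (3 * k / (n * p ^ 2))

theorem KE_single {p : ℝ} (hp : 0 < p) (hp1 : p ≤ 1) (hk : 1 ≤ k) (hkn : k ≤ n)
    (g : Fin k → Fin n → ℝ)
    (hg : ∀ i x, |g i x| ≤ 1) {τ : Fin k × Fin k → Fin 3}
    {W : Finset (Fin k)} {N : Finset (Fin k × Fin k)} (hA : Adm τ W N) {b : ℕ} (hW : W.card ≤ b) :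
    PR (potEdges k n) p (fun G => Cod p b G ∧
      39 * (1 / p) ^ (W.card ^ 2) * rho k n p ^ N.card <
        |∑ t : Tup k n, ((n : ℝ) ^ k)⁻¹ * (∏ i, g i (t i)) * tm τ (XX p G t)|) ≤
      (1 / 169) ^ (k * n) := by
  have hn : 1 ≤ n := hk.trans hkn
  have hn0 : (0 : ℝ) < n := by exact_mod_cast hn
  have hk0 : (0 : ℝ) < k := by exact_mod_cast hk
  have hrho : 0 < rho k n p := by unfold rho; positivity
  have hrho2 : rho k n p ^ 2 = 3 * k / (n * p ^ 2) := Real.sq_sqrt (by positivity)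
  have h := chaos (pot := potEdges k n) hp hp1
    (fun (l : N) (b : Fin n × Fin n) => (s((l.1.1, b.1), (l.1.2, b.2)) : Sym2 (Vtx k n)))
    (by
      rintro ⟨l, hl⟩ b ⟨l', hl'⟩ b' hE
      have hlt := hA.lt l (by rw [hA.one l hl]; decide)
      have hlt' := hA.lt l' (by rw [hA.one l' hl']; decide)
      simp only [Sym2.eq_iff, Prod.mk.injEq] at hE
      rcases hE with hE | hE
      · exact ⟨Subtype.ext (Prod.ext hE.1.1 hE.2.1), Prod.ext hE.1.2 hE.2.2⟩
      · rw [hE.1.1, hE.2.1] at hlt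
        exact absurd hlt (not_lt.2 hlt'.le))
    (fun l b => mem_pot (hA.lt l.1 (by rw [hA.one l.1 l.2]; decide)).ne)
    (Psi p g τ N) (fun G l b z => Psi_insert p g hA G l b z)
    (3 * (1 / p) ^ (W.card ^ 2) / (n : ℝ) ^ (2 * N.card))
    (39 * (1 / p) ^ (W.card ^ 2) * rho k n p ^ N.card) (by positivity) (by positivity) (k * n)
    (by simp; gcongr)
  refine le_trans (EX_mono hp.le hp1 fun G => ?_) (h.trans (le_of_eq ?_))
  · beta_reduce
    rw [sum_eq_Psi p g τ N hA.one]
    by_cases h1 : Cod p b G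
    · have := Psi_le hp hp1 hn g hg hA hW h1
      simp only [h1, this, implies_true, true_and, le_refl]
    · simp only [h1, false_and, if_false]
      split_ifs <;> norm_num
  · congr 1
    simp only [Fintype.card_prod, Fintype.card_fin, Fintype.card_coe]
    push_cast
    rw [mul_pow (39 * (1 / p) ^ (W.card ^ 2)), pow_right_comm (rho k n p), hrho2]
    have : (1 / p) ^ 2 * ((n : ℝ) * n * (3 * (k * n))) = (n : ℝ) ^ 4 * (3 * k / (n * p ^ 2)) := by
      field_simp
    rw [this, mul_pow]
    have h4 : (3 * (1 / p) ^ (W.card ^ 2) / (n : ℝ) ^ (2 * N.card)) ^ 2 * ((n : ℝ) ^ 4) ^ N.card =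
        9 * ((1 / p) ^ (W.card ^ 2)) ^ 2 := by
      rw [div_pow, ← pow_mul, ← pow_mul, show 2 * N.card * 2 = 4 * N.card by ring, mul_pow]
      field_simp
      norm_num
    rw [← mul_assoc, h4, mul_pow]
    have h5 : (0 : ℝ) < (1 / p) ^ (W.card ^ 2) := by positivity
    have h6 : (0 : ℝ) < (3 * k / (n * p ^ 2)) ^ N.card := by positivity
    generalize (1 / p) ^ (W.card ^ 2) = a at h5
    generalize (3 * (k : ℝ) / (n * p ^ 2)) ^ N.card = c at h6
    field_simp
    norm_num

/-- The event that all twisted product terms are small. -/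
def KEgood (p : ℝ) (b : ℕ) (G : Finset (Sym2 (Vtx k n))) : Prop :=
  ∀ (σ : Fin k → Fin n → SignType) (τ : Fin k × Fin k → Fin 3) (W : Finset (Fin k))
    (N : Finset (Fin k × Fin k)), Adm τ W N → W.card ≤ b →
    |∑ t : Tup k n, ((n : ℝ) ^ k)⁻¹ * (∏ i, (σ i (t i) : ℝ)) * tm τ (XX p G t)| ≤
      39 * (1 / p) ^ (W.card ^ 2) * rho k n p ^ N.card

theorem KE_fail {p : ℝ} (hp : 0 < p) (hp1 : p ≤ 1) (hk : 1 ≤ k) (hkn : k ≤ n) (b : ℕ) :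
    PR (potEdges k n) p (fun G => Cod p b G ∧ ¬ KEgood p b G) ≤ (1 / 2) ^ (k * n) := by
  classical
  have hn : 1 ≤ n := hk.trans hkn
  have h := PR_union (pot := potEdges k n)
    (s := (univ : Finset ((Fin k → Fin n → SignType) × (Fin k × Fin k → Fin 3) ×
      Finset (Fin k) × Finset (Fin k × Fin k)))) hp.le hp1
    (fun G => Cod p b G ∧ ¬ KEgood p b G)
    (fun i G => (Adm i.2.1 i.2.2.1 i.2.2.2 ∧ i.2.2.1.card ≤ b) ∧ Cod p b G ∧
      39 * (1 / p) ^ (i.2.2.1.card ^ 2) * rho k n p ^ i.2.2.2.card <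
        |∑ t : Tup k n, ((n : ℝ) ^ k)⁻¹ * (∏ j, (i.1 j (t j) : ℝ)) * tm i.2.1 (XX p G t)|)
    (fun _ => (1 / 169) ^ (k * n)) (by
      rintro G ⟨hC, hG⟩
      unfold KEgood at hG
      push Not at hG
      obtain ⟨σ, τ, W, N, h1, h2, h3⟩ := hG
      exact ⟨(σ, τ, W, N), mem_univ _, ⟨h1, h2⟩, hC, h3⟩) (by
      rintro ⟨σ, τ, W, N⟩ -
      by_cases h1 : Adm τ W N ∧ W.card ≤ b
      · simp only [h1, and_self, true_and]
        refine KE_single hp hp1 hk hkn (fun i x => (σ i x : ℝ)) (fun i x => ?_) h1.1 h1.2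
        rcases σ i x <;> simp
      · simp only [h1, false_and]
        unfold PR
        simp only [if_false, EX_const]
        positivity)
  refine h.trans ?_
  rw [sum_const, nsmul_eq_mul, card_univ]
  have hcard : Fintype.card ((Fin k → Fin n → SignType) × (Fin k × Fin k → Fin 3) ×
      Finset (Fin k) × Finset (Fin k × Fin k)) ≤ 36 ^ (k * n) := by
    have hS : Fintype.card SignType = 3 := rfl
    simp only [Fintype.card_prod, Fintype.card_fun, Fintype.card_finset, Fintype.card_fin, hS]
    have e1 : k * k ≤ k * n := Nat.mul_le_mul_left k hkn
    have e2 : k ≤ k * n := Nat.le_mul_of_pos_right k hn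
    calc (3 ^ n) ^ k * (3 ^ (k * k) * (2 ^ k * 2 ^ (k * k)))
        ≤ 3 ^ (k * n) * (3 ^ (k * n) * (2 ^ (k * n) * 2 ^ (k * n))) := by
          rw [← pow_mul, mul_comm n k]
          gcongr <;> norm_num
      _ = _ := by rw [← mul_pow, ← mul_pow, ← mul_pow]; norm_num
  have hcard' : (Fintype.card ((Fin k → Fin n → SignType) × (Fin k × Fin k → Fin 3) ×
      Finset (Fin k) × Finset (Fin k × Fin k)) : ℝ) ≤ 36 ^ (k * n) := by exact_mod_cast hcard
  calc _ ≤ (36 : ℝ) ^ (k * n) * (1 / 169) ^ (k * n) := by gcongr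
    _ = (36 / 169) ^ (k * n) := by rw [← mul_pow]; norm_num
    _ ≤ _ := pow_le_pow_left₀ (by norm_num) (by norm_num) _

end KE2

section det
variable {k n : ℕ}

/-- All pairs of blocks in increasing order. -/
noncomputable def prs (k : ℕ) : List (Fin k × Fin k) :=
  (univ.filter fun e : Fin k × Fin k => e.1 < e.2).toList

theorem prs_nodup : (prs k).Nodup := nodup_toList _

theorem mem_prs {e : Fin k × Fin k} : e ∈ prs k ↔ e.1 < e.2 := by simp [prs]

theorem prs_length : (prs k).length ≤ k ^ 2 := by
  unfold prs
  rw [length_toList]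
  refine (card_le_univ _).trans ?_
  simp [sq]

theorem prod_le_three (m : ℕ) (q : ℕ) (hm : m ≤ q) (x : ℝ) (hx : 0 ≤ x) (hxq : x ≤ 1 / q) :
    (1 + x) ^ m ≤ 3 := by
  calc (1 + x) ^ m ≤ (1 + x) ^ q := pow_le_pow_right₀ (by linarith) hm
    _ ≤ (1 + 1 / (q : ℝ)) ^ q := by gcongr
    _ ≤ 3 := one_add_inv_pow_le q

theorem det_bound {p : ℝ} (hp : 0 < p) (hp1 : p ≤ 1) (hk : 1 ≤ k) (hn : 1 ≤ n) (d : ℕ)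
    (G : Finset (Sym2 (Vtx k n))) (hG : KEgood p (2 * d + 2) G) (hrho : rho k n p ≤ 1)
    (hθ : 234 * (k : ℝ) ^ 2 * ((1 / p) ^ (4 * d) * rho k n p) ≤ 1)
    (π : SemProof (k * n)) (hπ : IsRefutation (ResLinLines (k * n)) (bcliqueU k n G) π) :
    1 / 2 ≤ π.length * (117 * (1 / p) ^ ((2 * d + 2) ^ 2) * rho k n p ^ (d - 1) *
      (k : ℝ) ^ (4 * d + 4)) := by
  classical
  have hn0 : (0 : ℝ) < n := by exact_mod_cast hn
  have hk1 : (1 : ℝ) ≤ k := by exact_mod_cast hk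
  have hk0 : (0 : ℝ) < k := by linarith
  have h1p : 1 ≤ 1 / p := by rw [le_div_iff₀ hp]; linarith
  have hrho0 : 0 ≤ rho k n p := Real.sqrt_nonneg _
  set θ := (1 / p) ^ (4 * d) * rho k n p with hθdef
  have hθ0 : 0 ≤ θ := by positivity
  have hlen : ((prs k).length : ℝ) ≤ (k : ℝ) ^ 2 := by exact_mod_cast prs_length (k := k)
  -- mass
  have hmass := mass_total (fun _ : Tup k n => ((n : ℝ) ^ k)⁻¹) (fun t => XX p G t) d
    (C := 39) (θ := θ) (by norm_num) hθ0 (by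
      simp only [sum_const, card_univ, nsmul_eq_mul, Fintype.card_fun, Fintype.card_fin]
      push_cast
      exact mul_inv_cancel₀ (by positivity)) (by
      intro τ W N hA hW hWN
      have h1 := hG (fun _ _ => 1) τ W N hA (by omega)
      simp only [SignType.coe_one, prod_const_one, mul_one] at h1
      refine h1.trans ?_
      rw [hθdef, mul_pow, ← pow_mul, mul_assoc]
      have : W.card ^ 2 ≤ 4 * d * N.card := by
        calc W.card ^ 2 = W.card * (2 * N.card) := by rw [sq, ← hWN]
          _ ≤ 2 * d * (2 * N.card) := by gcongr
          _ = _ := by ring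
      gcongr) (prs k) prs_nodup (fun e he => mem_prs.1 he)
  have h3 : (1 + θ) ^ (prs k).length ≤ 3 := by
    refine prod_le_three _ (k ^ 2) prs_length θ hθ0 ?_
    push_cast
    rw [le_div_iff₀ (by positivity)]
    nlinarith [mul_nonneg hθ0 (sq_nonneg (k : ℝ))]
  have hm2 : |∑ t : Tup k n, ((n : ℝ) ^ k)⁻¹ * pp d (XX p G t) (prs k) ∅ - 1| ≤ 1 / 2 := by
    refine hmass.trans ?_
    calc ((prs k).length : ℝ) * (39 * θ * (1 + θ) ^ (prs k).length)
        ≤ (k : ℝ) ^ 2 * (39 * θ * 3) := by gcongr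
      _ ≤ 1 / 2 := by linarith
  have hm3 : 1 / 2 ≤ |∑ t : Tup k n, ((n : ℝ) ^ k)⁻¹ * pp d (XX p G t) (prs k) ∅| := by
    have := abs_le.1 hm2
    refine le_trans ?_ (le_abs_self _)
    linarith [this.1]
  refine hm3.trans ?_
  refine reduction' G (fun t => ((n : ℝ) ^ k)⁻¹ * pp d (XX p G t) (prs k) ∅) _ (by positivity) ?_
    π hπ
  intro u v huv huvG g hg
  set σ : Fin k → Fin n → SignType := fun i x =>
    if (i = u.1 ∧ x ≠ u.2) ∨ (i = v.1 ∧ x ≠ v.2) then 0 else SignType.sign (g i x) with hσ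
  have hsg : ∀ i x, ((SignType.sign (g i x) : SignType) : ℝ) = g i x := by
    intro i x
    rcases hg i x with h | h <;> rw [h] <;> simp
  have hσ1 : ∀ t : Tup k n, (∏ i, (σ i (t i) : ℝ)) =
      if t u.1 = u.2 ∧ t v.1 = v.2 then ∏ i, g i (t i) else 0 := by
    intro t
    split_ifs with h
    · refine prod_congr rfl fun i _ => ?_
      have : ¬ ((i = u.1 ∧ t i ≠ u.2) ∨ (i = v.1 ∧ t i ≠ v.2)) := by
        rintro (⟨rfl, h1⟩ | ⟨rfl, h1⟩)
        · exact h1 h.1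
        · exact h1 h.2
      simp only [hσ, this, if_false, hsg]
    · rw [not_and_or] at h
      rcases h with h | h
      · refine prod_eq_zero (mem_univ u.1) ?_
        simp [hσ, h]
      · refine prod_eq_zero (mem_univ v.1) ?_
        simp [hσ, h]
  have hres := resid_total (fun t : Tup k n => ((n : ℝ) ^ k)⁻¹ * ∏ i, (σ i (t i) : ℝ))
    (fun t => XX p G t) d (39 * (1 / p) ^ ((2 * d + 2) ^ 2) * rho k n p ^ (d - 1)) (by positivity)
    (R := k) hk1 (by
      intro τ W N hA hW hN
      refine (hG σ τ W N hA hW).trans ?_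
      have h5 : rho k n p ^ N.card ≤ rho k n p ^ (d - 1) :=
        pow_le_pow_of_le_one hrho0 hrho (by omega)
      gcongr) (u.1, v.1) (by
      intro t
      by_cases h : t u.1 = u.2 ∧ t v.1 = v.2
      · right
        simp only [XX, ch, h.1, h.2]
        rw [if_neg huvG]
      · left
        simp only [hσ1, h, if_false, mul_zero]) (prs k) prs_nodup (fun e he => mem_prs.1 he)
    (mem_prs.2 huv)
  have heq : ∑ t : Tup k n, (if t u.1 = u.2 ∧ t v.1 = v.2 then
      ((n : ℝ) ^ k)⁻¹ * pp d (XX p G t) (prs k) ∅ else 0) * ∏ i, g i (t i) =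
      ∑ t : Tup k n, ((n : ℝ) ^ k)⁻¹ * (∏ i, (σ i (t i) : ℝ)) * pp d (XX p G t) (prs k) ∅ := by
    refine sum_congr rfl fun t _ => ?_
    rw [hσ1]
    split_ifs <;> ring
  rw [heq]
  refine hres.trans ?_
  have h4 : (1 + 1 / (k : ℝ) ^ 2) ^ (prs k).length ≤ 3 := by
    refine prod_le_three _ (k ^ 2) prs_length _ (by positivity) ?_
    push_cast
    exact le_refl _
  calc _ ≤ 39 * (1 / p) ^ ((2 * d + 2) ^ 2) * rho k n p ^ (d - 1) * (k : ℝ) ^ (4 * d + 4) * 3 := by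
        gcongr
    _ = _ := by ring

/-- The trivial bound. -/
theorem triv_bound (hn : 1 ≤ n) (G : Finset (Sym2 (Vtx k n)))
    (π : SemProof (k * n)) (hπ : IsRefutation (ResLinLines (k * n)) (bcliqueU k n G) π) :
    (n : ℝ) ^ 2 ≤ π.length := by
  classical
  have hn0 : (0 : ℝ) < n := by exact_mod_cast hn
  have h := reduction' G (fun _ => ((n : ℝ) ^ k)⁻¹) (((n : ℝ) ^ 2)⁻¹) (by positivity) (by
    intro u v huv _ g hg
    have hcount : (univ.filter fun t : Tup k n => t u.1 = u.2 ∧ t v.1 = v.2).card * n ^ 2 ≤ n ^ k := by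
      have h1 := card_fib (n := n) ({(u.1, v.1)} : Finset (Fin k × Fin k))
        (by
          intro e he e' he' hne
          rw [mem_singleton] at he he'
          exact absurd (he.trans he'.symm) hne)
        (by intro e he; rw [mem_singleton] at he; subst he; exact huv)
        (fun _ => (u.2, v.2))
      rw [card_singleton, mul_one] at h1
      refine le_trans (Nat.mul_le_mul_right _ (card_le_card ?_)) h1
      intro t ht
      have ht := (mem_filter.1 ht).2
      refine mem_filter.2 ⟨mem_univ _, ?_⟩
      funext ⟨l, hl⟩
      rw [mem_singleton] at hl
      subst hl
      simp [vt, ht.1, ht.2]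
    have hcount' : ((univ.filter fun t : Tup k n => t u.1 = u.2 ∧ t v.1 = v.2).card : ℝ) * (n : ℝ) ^ 2
      ≤ (n : ℝ) ^ k := by exact_mod_cast hcount
    calc _ ≤ ∑ t : Tup k n, (if t u.1 = u.2 ∧ t v.1 = v.2 then ((n : ℝ) ^ k)⁻¹ else 0) := by
          refine (abs_sum_le_sum_abs _ _).trans (sum_le_sum fun t _ => ?_)
          rw [abs_mul, abs_prod]
          have h2 : ∏ i, |g i (t i)| = 1 := prod_eq_one fun i _ => by
            rcases hg i (t i) with h | h <;> rw [h] <;> simp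
          rw [h2, mul_one]
          split_ifs
          · rw [abs_of_nonneg (by positivity)]
          · simp
      _ = ((univ.filter fun t : Tup k n => t u.1 = u.2 ∧ t v.1 = v.2).card : ℝ) *
            ((n : ℝ) ^ k)⁻¹ := by rw [← sum_filter, sum_const, nsmul_eq_mul]
      _ ≤ _ := by
          rw [← div_eq_mul_inv, div_le_iff₀ (by positivity), inv_mul_eq_div,
            le_div_iff₀ (by positivity)]
          exact hcount') π hπ
  simp only [sum_const, card_univ, nsmul_eq_mul, Fintype.card_fun, Fintype.card_fin] at h
  push_cast at h
  rw [mul_inv_cancel₀ (by positivity), abs_one, ← div_eq_mul_inv, le_div_iff₀ (by positivity),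
    one_mul] at h
  exact h

end det

theorem params {k n D d : ℕ} (hk : 1 ≤ k) (hn : (234 : ℝ) ^ 10 ≤ n)
    (hkn : (k : ℝ) ≤ (n : ℝ) ^ ((1 : ℝ) / 64)) (hd : 4 ≤ d) (hd1 : 1000 * d ≤ D)
    (hd2 : D ≤ 1000 * d + 1000) :
    rho k n ((n : ℝ) ^ (-(2 : ℝ) / (D : ℝ))) ≤ 1 ∧
    234 * (k : ℝ) ^ 2 * ((1 / ((n : ℝ) ^ (-(2 : ℝ) / (D : ℝ)))) ^ (4 * d) *
      rho k n ((n : ℝ) ^ (-(2 : ℝ) / (D : ℝ)))) ≤ 1 ∧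
    2 * (n : ℝ) ^ (1 / 20000 * (D : ℝ)) * (117 * (1 / ((n : ℝ) ^ (-(2 : ℝ) / (D : ℝ)))) ^
      ((2 * d + 2) ^ 2) * rho k n ((n : ℝ) ^ (-(2 : ℝ) / (D : ℝ))) ^ (d - 1) *
      (k : ℝ) ^ (4 * d + 4)) ≤ 1 ∧
    (n : ℝ) ^ ((1 : ℝ) / 2) ≤
      ((n : ℝ) ^ (-(2 : ℝ) / (D : ℝ))) ^ (2 * d + 2) * n / k ^ 2 := by
  have hN1 : (1 : ℝ) ≤ n := le_trans (by norm_num) hn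
  have hN0 : (0 : ℝ) < n := by linarith
  have hk0 : (0 : ℝ) < k := by exact_mod_cast hk
  have hd' : (4 : ℝ) ≤ d := by exact_mod_cast hd
  have hd1' : 1000 * (d : ℝ) ≤ D := by exact_mod_cast hd1
  have hd2' : (D : ℝ) ≤ 1000 * d + 1000 := by exact_mod_cast hd2
  have hD0 : (0 : ℝ) < D := by linarith
  set N : ℝ := (n : ℝ) with hN
  have h234 : (234 : ℝ) ≤ N ^ ((1 : ℝ) / 10) := by
    calc (234 : ℝ) = ((234 : ℝ) ^ 10) ^ ((1 : ℝ) / 10) := by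
          rw [← Real.rpow_natCast, ← Real.rpow_mul (by norm_num)]; norm_num
      _ ≤ _ := Real.rpow_le_rpow (by norm_num) hn (by norm_num)
  have hmono : ∀ {a b : ℝ}, a ≤ b → N ^ a ≤ N ^ b := fun h => Real.rpow_le_rpow_of_exponent_le hN1 h
  have hinvp : ∀ q : ℕ, (1 / (N ^ (-(2 : ℝ) / D))) ^ q = N ^ (2 * q / D : ℝ) := by
    intro q
    rw [one_div, ← Real.rpow_neg hN0.le, ← Real.rpow_natCast, ← Real.rpow_mul hN0.le]
    congr 1; ring
  have hpq : ∀ q : ℕ, (N ^ (-(2 : ℝ) / D)) ^ q = N ^ (-(2 * q / D) : ℝ) := by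
    intro q
    rw [← Real.rpow_natCast, ← Real.rpow_mul hN0.le]
    congr 1; ring
  have hkq : ∀ q : ℕ, (k : ℝ) ^ q ≤ N ^ (q / 64 : ℝ) := by
    intro q
    calc (k : ℝ) ^ q ≤ (N ^ ((1 : ℝ) / 64)) ^ q := pow_le_pow_left₀ hk0.le hkn q
      _ = _ := by rw [← Real.rpow_natCast, ← Real.rpow_mul hN0.le]; congr 1; ring
  have h2D : 2 / (D : ℝ) ≤ 1 / 2000 := by
    rw [div_le_div_iff₀ hD0 (by norm_num)]; linarith
  -- rho
  have hrho : rho k n (N ^ (-(2 : ℝ) / D)) ≤ N ^ (-(2 : ℝ) / 5) := by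
    unfold rho
    rw [Real.sqrt_le_left (by positivity), hpq 2, ← Real.rpow_natCast (N ^ (-(2 : ℝ) / 5)),
      ← Real.rpow_mul hN0.le, div_le_iff₀ (by positivity)]
    calc 3 * (k : ℝ) ≤ N ^ ((1 : ℝ) / 10) * N ^ ((1 : ℝ) / 64) :=
          mul_le_mul (by linarith) hkn hk0.le (by positivity)
      _ = N ^ ((1 : ℝ) / 10 + 1 / 64) := (Real.rpow_add hN0 _ _).symm
      _ ≤ N ^ (-(2 : ℝ) / 5 * (2 : ℕ) + (1 + -(2 * (2 : ℕ) / D))) := by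
          apply hmono
          have : 2 * ((2 : ℕ) : ℝ) / D = 2 * (2 / D) := by push_cast; ring
          rw [this]; push_cast; linarith
      _ = _ := by rw [Real.rpow_add hN0, Real.rpow_add hN0, Real.rpow_one]
  have hrho0 : 0 ≤ rho k n (N ^ (-(2 : ℝ) / D)) := Real.sqrt_nonneg _
  refine ⟨?_, ?_, ?_, ?_⟩
  · refine hrho.trans ?_
    calc N ^ (-(2 : ℝ) / 5) ≤ N ^ (0 : ℝ) := hmono (by norm_num)
      _ = 1 := Real.rpow_zero _
  · rw [hinvp]
    calc 234 * (k : ℝ) ^ 2 * (N ^ (2 * (4 * d : ℕ) / D : ℝ) * rho k n (N ^ (-(2 : ℝ) / D)))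
        ≤ N ^ ((1 : ℝ) / 10) * N ^ ((2 : ℕ) / 64 : ℝ) *
          (N ^ ((1 : ℝ) / 10) * N ^ (-(2 : ℝ) / 5)) := by
          have h1 : N ^ (2 * (4 * d : ℕ) / D : ℝ) ≤ N ^ ((1 : ℝ) / 10) := by
            apply hmono
            push_cast
            rw [div_le_div_iff₀ hD0 (by norm_num)]; linarith
          have h2 := hkq 2
          gcongr
      _ = N ^ ((1 : ℝ) / 10 + (2 : ℕ) / 64 + (1 / 10 + -(2 : ℝ) / 5)) := by
          rw [Real.rpow_add hN0, Real.rpow_add hN0, Real.rpow_add hN0]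
      _ ≤ N ^ (0 : ℝ) := hmono (by norm_num)
      _ = 1 := Real.rpow_zero _
  · rw [hinvp]
    have h1 : N ^ (2 * ((2 * d + 2) ^ 2 : ℕ) / D : ℝ) ≤ N ^ ((d : ℝ) / 50) := by
      apply hmono
      push_cast
      rw [div_le_div_iff₀ hD0 (by norm_num)]
      have : 2 * (2 * (d : ℝ) + 2) ^ 2 * 50 ≤ d * (1000 * d) := by nlinarith
      nlinarith
    have h2 : rho k n (N ^ (-(2 : ℝ) / D)) ^ (d - 1) ≤ N ^ (-(3 : ℝ) / 10 * d) := by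
      calc _ ≤ (N ^ (-(2 : ℝ) / 5)) ^ (d - 1) := pow_le_pow_left₀ hrho0 hrho _
        _ = N ^ (-(2 : ℝ) / 5 * (d - 1 : ℕ)) := by rw [← Real.rpow_natCast, ← Real.rpow_mul hN0.le]
        _ ≤ _ := by
            apply hmono
            rw [Nat.cast_sub (by omega)]
            push_cast
            linarith
    have h3 : (k : ℝ) ^ (4 * d + 4) ≤ N ^ ((5 : ℝ) / 64 * d) := by
      refine (hkq _).trans (hmono ?_)
      push_cast
      linarith
    have h4 : N ^ (1 / 20000 * (D : ℝ)) ≤ N ^ ((1 : ℝ) / 10 * d) := by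
      apply hmono; linarith
    calc _ = 234 * N ^ (1 / 20000 * (D : ℝ)) * (N ^ (2 * ((2 * d + 2) ^ 2 : ℕ) / D : ℝ) *
          rho k n (N ^ (-(2 : ℝ) / D)) ^ (d - 1) * (k : ℝ) ^ (4 * d + 4)) := by ring
      _ ≤ N ^ ((1 : ℝ) / 10) * N ^ ((1 : ℝ) / 10 * d) * (N ^ ((d : ℝ) / 50) *
          N ^ (-(3 : ℝ) / 10 * d) * N ^ ((5 : ℝ) / 64 * d)) := by gcongr
      _ = N ^ ((1 : ℝ) / 10 + 1 / 10 * d + ((d : ℝ) / 50 + -(3 : ℝ) / 10 * d + (5 : ℝ) / 64 * d)) := by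
          simp only [Real.rpow_add hN0]
      _ ≤ N ^ (0 : ℝ) := hmono (by linarith)
      _ = 1 := Real.rpow_zero _
  · rw [hpq, le_div_iff₀ (by positivity)]
    calc N ^ ((1 : ℝ) / 2) * (k : ℝ) ^ 2 ≤ N ^ ((1 : ℝ) / 2) * N ^ ((2 : ℕ) / 64 : ℝ) := by
          have := hkq 2
          gcongr
      _ = N ^ ((1 : ℝ) / 2 + (2 : ℕ) / 64) := (Real.rpow_add hN0 _ _).symm
      _ ≤ N ^ (-(2 * (2 * d + 2 : ℕ) / D : ℝ) + 1) := by
          apply hmono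
          have : 2 * ((2 * d + 2 : ℕ) : ℝ) / D ≤ 1 / 10 := by
            push_cast
            rw [div_le_div_iff₀ hD0 (by norm_num)]; linarith
          push_cast at this ⊢
          linarith
      _ = _ := by rw [Real.rpow_add hN0, Real.rpow_one]

theorem fail_bound {k n : ℕ} (γ : ℝ) (hγ : 0 < γ) (hk : 1 ≤ k) (hn : (234 : ℝ) ^ 10 ≤ n)
    (hnγ : (16 / γ) ^ 2 ≤ n) (hnγ2 : 2 / γ ≤ n)
    (hkn : (k : ℝ) ≤ (n : ℝ) ^ ((1 : ℝ) / 64)) (a : ℝ) (ha : (n : ℝ) ^ ((1 : ℝ) / 2) ≤ a) :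
    (k : ℝ) * 2 ^ k * n ^ k * Real.exp (-(a / 4)) + (1 / 2) ^ (k * n) ≤ γ := by
  have hN1 : (1 : ℝ) ≤ n := le_trans (by norm_num) hn
  have hN0 : (0 : ℝ) < n := by linarith
  have hk0 : (0 : ℝ) < k := by exact_mod_cast hk
  have hn1 : 1 ≤ n := by exact_mod_cast hN1
  have hsecond : ((1 : ℝ) / 2) ^ (k * n) ≤ γ / 2 := by
    calc ((1 : ℝ) / 2) ^ (k * n) ≤ (1 / 2) ^ n :=
          pow_le_pow_of_le_one (by norm_num) (by norm_num) (Nat.le_mul_of_pos_left n hk)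
      _ = 1 / 2 ^ n := by rw [div_pow, one_pow]
      _ ≤ 1 / n := by
          gcongr
          exact_mod_cast (Nat.lt_two_pow_self (n := n)).le
      _ ≤ γ / 2 := by
          rw [div_le_iff₀ hγ] at hnγ2
          rw [div_le_div_iff₀ hN0 (by norm_num)]
          linarith
  set N : ℝ := (n : ℝ) with hN
  have hfirst : (k : ℝ) * 2 ^ k * N ^ k ≤ Real.exp (3 * k * Real.log N) := by
    have h2 : (2 : ℝ) ≤ N := le_trans (by norm_num) hn
    have hkN : (k : ℝ) ≤ N := hkn.trans (by
      calc N ^ ((1 : ℝ) / 64) ≤ N ^ (1 : ℝ) := Real.rpow_le_rpow_of_exponent_le hN1 (by norm_num)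
        _ = N := Real.rpow_one N)
    have h3 : Real.exp (3 * k * Real.log N) = N ^ k * N ^ k * N ^ k := by
      have : 3 * k * Real.log N = (3 * k : ℕ) * Real.log N := by push_cast; ring
      rw [this, Real.exp_nat_mul, Real.exp_log hN0]
      ring
    rw [h3]
    have h4 : N ≤ N ^ k := le_self_pow₀ hN1 (by omega)
    have h5 : (k : ℝ) ≤ N ^ k := hkN.trans h4
    gcongr
  have hlog : Real.log N ≤ 4 * N ^ ((1 : ℝ) / 4) := by
    have := Real.log_le_rpow_div hN0.le (show (0 : ℝ) < 1 / 4 by norm_num)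
    linarith
  have hlog0 : 0 ≤ Real.log N := Real.log_nonneg hN1
  have h6 : (96 : ℝ) ≤ N ^ ((1 : ℝ) / 6) := by
    calc (96 : ℝ) = ((96 : ℝ) ^ 6) ^ ((1 : ℝ) / 6) := by
          rw [← Real.rpow_natCast, ← Real.rpow_mul (by norm_num)]; norm_num
      _ ≤ _ := Real.rpow_le_rpow (by norm_num) (le_trans (by norm_num) hn) (by norm_num)
  have h7 : 3 * k * Real.log N ≤ N ^ ((1 : ℝ) / 2) / 8 := by
    have e1 : 3 * k * Real.log N ≤ 3 * N ^ ((1 : ℝ) / 64) * (4 * N ^ ((1 : ℝ) / 4)) := by gcongr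
    have e2 : N ^ ((1 : ℝ) / 64) * N ^ ((1 : ℝ) / 4) ≤ N ^ ((1 : ℝ) / 3) := by
      rw [← Real.rpow_add hN0]
      exact Real.rpow_le_rpow_of_exponent_le hN1 (by norm_num)
    have e3 : N ^ ((1 : ℝ) / 3) * N ^ ((1 : ℝ) / 6) = N ^ ((1 : ℝ) / 2) := by
      rw [← Real.rpow_add hN0]; norm_num
    have e4 : 0 ≤ N ^ ((1 : ℝ) / 3) := by positivity
    nlinarith
  have h8 : 16 / γ ≤ N ^ ((1 : ℝ) / 2) := by
    rw [← Real.sqrt_eq_rpow]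
    exact Real.le_sqrt_of_sq_le hnγ
  have h9 : (k : ℝ) * 2 ^ k * N ^ k * Real.exp (-(a / 4)) ≤ γ / 2 := by
    calc _ ≤ Real.exp (3 * k * Real.log N) * Real.exp (-(a / 4)) := by gcongr
      _ = Real.exp (3 * k * Real.log N + -(a / 4)) := (Real.exp_add _ _).symm
      _ ≤ Real.exp (-(2 / γ)) := by
          apply Real.exp_le_exp.2
          have : 16 / γ = 8 * (2 / γ) := by ring
          linarith
      _ ≤ γ / 2 := by
          rw [Real.exp_neg]
          rw [inv_le_comm₀ (Real.exp_pos _) (by positivity), inv_div]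
          linarith [Real.add_one_le_exp (2 / γ)]
  linarith

theorem k_zero {n : ℕ} (G : Finset (Sym2 (Vtx 0 n)))
    (π : SemProof (0 * n)) (hπ : IsRefutation (ResLinLines (0 * n)) (bcliqueU 0 n G) π) :
    False := by
  have := reduction' G (fun _ => 1) 0 le_rfl (fun u => u.1.elim0) π hπ
  simp at this
  linarith

/-- Corollary 4.6: there is an absolute constant `c > 0` such that
for all integers `D, k, n` with `k ≤ n^{1/64}` and `D ≤ 2 log n`: if
`G ∼ G(n,k,n^{−2/D})`, then with probability tending to `1` as `n → ∞` every tree-like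
semantic `Res(⊕)` refutation of `bclique_u(G,k)` has length at least `n^{cD}`. -/
theorem treelike_reslin_lower_bound :
    ∃ c > (0 : ℝ), ∀ γ > (0 : ℝ), ∃ n₀ : ℕ, ∀ n ≥ n₀, ∀ k D : ℕ,
      1 ≤ D → (k : ℝ) ≤ (n : ℝ) ^ ((1 : ℝ) / 64) → (D : ℝ) ≤ 2 * Real.logb 2 n →
      1 - γ ≤
        probG k n ((n : ℝ) ^ (-(2 : ℝ) / (D : ℝ))) (fun G =>
          ∀ π : SemProof (k * n), IsRefutation (ResLinLines (k * n)) (bcliqueU k n G) π →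
            (n : ℝ) ^ (c * (D : ℝ)) ≤ (π.length : ℝ)) := by
  refine ⟨1 / 20000, by norm_num, fun γ hγ => ⟨⌈(234 : ℝ) ^ 10 + (16 / γ) ^ 2 + 2 / γ⌉₊, ?_⟩⟩
  intro n hn k D hD hkn _
  have hn' : (234 : ℝ) ^ 10 + (16 / γ) ^ 2 + 2 / γ ≤ n := Nat.ceil_le.1 hn
  have g1 : 0 ≤ (16 / γ) ^ 2 := by positivity
  have g2 : 0 ≤ 2 / γ := by positivity
  have hn1 : (234 : ℝ) ^ 10 ≤ n := by linarith
  have hn2 : (16 / γ) ^ 2 ≤ (n : ℝ) := le_trans (by linarith [show (0:ℝ) ≤ 234 ^ 10 by norm_num]) hn'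
  have hn3 : 2 / γ ≤ (n : ℝ) := le_trans (by linarith [show (0:ℝ) ≤ 234 ^ 10 by norm_num]) hn'
  have hN1 : (1 : ℝ) ≤ n := le_trans (by norm_num) hn1
  have hN0 : (0 : ℝ) < n := by linarith
  have hnn : 1 ≤ n := by exact_mod_cast hN1
  have hD0 : (0 : ℝ) < D := by exact_mod_cast hD
  have hp : 0 < (n : ℝ) ^ (-(2 : ℝ) / (D : ℝ)) := by positivity
  have hp1 : (n : ℝ) ^ (-(2 : ℝ) / (D : ℝ)) ≤ 1 :=
    Real.rpow_le_one_of_one_le_of_nonpos hN1 (div_nonpos_of_nonpos_of_nonneg (by norm_num) hD0.le)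
  rcases Nat.eq_zero_or_pos k with rfl | hk
  · refine le_trans ?_ (probG_ge hp.le hp1 _ (fun _ => False) (fun G _ π hπ => (k_zero G π hπ).elim))
    unfold PR
    simp only [if_false, EX_const]
    linarith
  by_cases hDs : D ≤ 40000
  · refine le_trans ?_ (probG_ge hp.le hp1 _ (fun _ => False) (fun G _ π hπ => ?_))
    · unfold PR
      simp only [if_false, EX_const]
      linarith
    · refine le_trans ?_ (triv_bound hnn G π hπ)
      rw [← Real.rpow_natCast]
      refine Real.rpow_le_rpow_of_exponent_le hN1 ?_
      have : (D : ℝ) ≤ 40000 := by exact_mod_cast hDs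
      push_cast
      linarith
  have hkN : k ≤ n := by
    have : (k : ℝ) ≤ n := hkn.trans (by
      calc (n : ℝ) ^ ((1 : ℝ) / 64) ≤ (n : ℝ) ^ (1 : ℝ) :=
            Real.rpow_le_rpow_of_exponent_le hN1 (by norm_num)
        _ = n := Real.rpow_one _)
    exact_mod_cast this
  obtain ⟨q1, q2, q3, q4⟩ := params (d := D / 1000) (D := D) hk hn1 hkn (by omega) (by omega) (by omega)
  have hprob := probG_ge hp.le hp1 (fun G =>
          ∀ π : SemProof (k * n), IsRefutation (ResLinLines (k * n)) (bcliqueU k n G) π →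
            (n : ℝ) ^ (1 / 20000 * (D : ℝ)) ≤ (π.length : ℝ))
    (fun G => ¬ KEgood ((n : ℝ) ^ (-(2 : ℝ) / (D : ℝ))) (2 * (D / 1000) + 2) G) (by
      intro G hG π hπ
      rw [not_not] at hG
      have h1 := det_bound hp hp1 hk hnn (D / 1000) G hG q1 q2 π hπ
      set Λ := 117 * (1 / ((n : ℝ) ^ (-(2 : ℝ) / (D : ℝ)))) ^
        ((2 * (D / 1000) + 2) ^ 2) * rho k n ((n : ℝ) ^ (-(2 : ℝ) / (D : ℝ))) ^ (D / 1000 - 1) *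
        (k : ℝ) ^ (4 * (D / 1000) + 4) with hΛ
      have hrho0 : 0 ≤ rho k n ((n : ℝ) ^ (-(2 : ℝ) / (D : ℝ))) := Real.sqrt_nonneg _
      have hΛ0 : 0 ≤ Λ := by positivity
      have hΛ1 : 0 < Λ := by
        rcases hΛ0.lt_or_eq with h | h
        · exact h
        · rw [← h] at h1; norm_num at h1
      refine le_of_mul_le_mul_right ?_ hΛ1
      linarith)
  refine le_trans ?_ hprob
  have hbad := PR_or (pot := potEdges k n) hp.le hp1
    (fun G => ¬ KEgood ((n : ℝ) ^ (-(2 : ℝ) / (D : ℝ))) (2 * (D / 1000) + 2) G)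
    (fun G => ¬ Cod ((n : ℝ) ^ (-(2 : ℝ) / (D : ℝ))) (2 * (D / 1000) + 2) G)
    (fun G => Cod ((n : ℝ) ^ (-(2 : ℝ) / (D : ℝ))) (2 * (D / 1000) + 2) G ∧
      ¬ KEgood ((n : ℝ) ^ (-(2 : ℝ) / (D : ℝ))) (2 * (D / 1000) + 2) G)
    (fun G h => by
      by_cases hc : Cod ((n : ℝ) ^ (-(2 : ℝ) / (D : ℝ))) (2 * (D / 1000) + 2) G
      · exact Or.inr ⟨hc, h⟩
      · exact Or.inl hc)
  have hb1 := cod_fail (k := k) (n := n) hp hp1 (2 * (D / 1000) + 2) hk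
  have hb2 := KE_fail (k := k) (n := n) hp hp1 hk hkN (2 * (D / 1000) + 2)
  have hfb := fail_bound γ hγ hk hn1 hn2 hn3 hkn _ q4
  have heq : ((n : ℝ) ^ (-(2 : ℝ) / (D : ℝ))) ^ (2 * (D / 1000) + 2) * n / (4 * (k : ℝ) ^ 2) =
      ((n : ℝ) ^ (-(2 : ℝ) / (D : ℝ))) ^ (2 * (D / 1000) + 2) * n / (k : ℝ) ^ 2 / 4 := by
    rw [div_div, mul_comm (4 : ℝ)]
  rw [heq] at hb1
  linarith
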